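/- arXiv:1301.6667 — 3 statements merged into one kernel-verified Lean document; each statement's English description precedes it below -/
import Mathlib

section
/- Let S be an antipodal point set of 2n points on the unit circle. For every non-thick antipodal polygon P on S there exists a thick antipodal polygon on S with strictly larger area. -/
open MeasureTheory

/-- The point on the unit circle at angle `θ`. -/
noncomputable def pt (θ : ℝ) : ℝ × ℝ := (Real.cos θ, Real.sin θ)

/-- Standard dot product in the plane. -/
noncomputable def dotp (v w : ℝ × ℝ) : ℝ := v.1 * w.1 + v.2 * w.2

/-- Given angles `θ : Fin n → ℝ` (determining the antipodal point set
`{pt (θ i)} ∪ {-pt (θ i)}`) and a selection `ε`, the `i`-th vertex of the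
corresponding antipodal polygon: `pt (θ i)` if `ε i` and `-pt (θ i)` otherwise. -/
noncomputable def vtx {n : ℕ} (θ : Fin n → ℝ) (ε : Fin n → Bool) (i : Fin n) : ℝ × ℝ :=
  if ε i then pt (θ i) else -pt (θ i)

/-- The antipodal polygon determined by the selection `ε`. -/
noncomputable def apoly {n : ℕ} (θ : Fin n → ℝ) (ε : Fin n → Bool) : Set (ℝ × ℝ) :=
  convexHull ℝ (Set.range (vtx θ ε))

/-- The antipodal polygon is thin: all vertices lie in a closed half-plane
bounded by a line through the origin. -/
def Thin {n : ℕ} (θ : Fin n → ℝ) (ε : Fin n → Bool) : Prop :=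
  ∃ v : ℝ × ℝ, v ≠ 0 ∧ ∀ i, 0 ≤ dotp v (vtx θ ε i)

/-- The antipodal polygon is thick: every open half-plane bounded by a line
through the origin contains at least `⌈(n-2)/2⌉ = (n-1)/2` of its vertices. -/
def Thick {n : ℕ} (θ : Fin n → ℝ) (ε : Fin n → Bool) : Prop :=
  ∀ v : ℝ × ℝ, v ≠ 0 →
    (n - 1) / 2 ≤ Set.ncard {i : Fin n | 0 < dotp v (vtx θ ε i)}

/-- The `j`-th point (indices mod `2*n`) of the antipodal point set in circular
order `pt (θ 0), …, pt (θ (n-1)), -pt (θ 0), …, -pt (θ (n-1))`. -/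
noncomputable def spt {n : ℕ} (θ : Fin n → ℝ) (j : ℕ) : ℝ × ℝ :=
  if h : j % (2 * n) < n then pt (θ ⟨j % (2 * n), h⟩)
  else if h2 : j % (2 * n) - n < n then -pt (θ ⟨j % (2 * n) - n, h2⟩) else 0

/-- Whether the `j`-th point (indices mod `2*n`) of the antipodal point set, in the
circular order `pt (θ 0), …, pt (θ (n-1)), -pt (θ 0), …, -pt (θ (n-1))`,
is a vertex of the antipodal polygon selected by `ε`. -/
def chosen {n : ℕ} (ε : Fin n → Bool) (j : ℕ) : Bool :=
  if h : j % (2 * n) < n then ε ⟨j % (2 * n), h⟩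
  else if h2 : j % (2 * n) - n < n then !(ε ⟨j % (2 * n) - n, h2⟩) else false

/-- Twice the signed area of the triangle `p q r`. -/
noncomputable def planeDet (p q r : ℝ × ℝ) : ℝ :=
  (q.1 - p.1) * (r.2 - p.2) - (q.2 - p.2) * (r.1 - p.1)

lemma volume_unit_triangle :
    volume {u : ℝ × ℝ | 0 ≤ u.1 ∧ 0 ≤ u.2 ∧ u.1 + u.2 ≤ 1} = ENNReal.ofReal (1 / 2) := by
  have hclosed : IsClosed {u : ℝ × ℝ | 0 ≤ u.1 ∧ 0 ≤ u.2 ∧ u.1 + u.2 ≤ 1} :=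
    (isClosed_le continuous_const continuous_fst).inter
      ((isClosed_le continuous_const continuous_snd).inter
        (isClosed_le (continuous_fst.add continuous_snd) continuous_const))
  have hslice : ∀ x : ℝ,
      volume (Prod.mk x ⁻¹' {u : ℝ × ℝ | 0 ≤ u.1 ∧ 0 ≤ u.2 ∧ u.1 + u.2 ≤ 1}) =
        (Set.Icc (0 : ℝ) 1).indicator (fun t => ENNReal.ofReal (1 - t)) x := by
    intro x
    by_cases hx : 0 ≤ x
    · have : Prod.mk x ⁻¹' {u : ℝ × ℝ | 0 ≤ u.1 ∧ 0 ≤ u.2 ∧ u.1 + u.2 ≤ 1} =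
          Set.Icc 0 (1 - x) := by
        ext y
        simp only [Set.mem_preimage, Set.mem_ofPred_eq, Set.mem_Icc]
        constructor
        · rintro ⟨-, h1, h2⟩; exact ⟨h1, by linarith⟩
        · rintro ⟨h1, h2⟩; exact ⟨hx, h1, by linarith⟩
      rw [this, Real.volume_Icc, sub_zero]
      by_cases hx1 : x ≤ 1
      · rw [Set.indicator_of_mem (show x ∈ Set.Icc (0 : ℝ) 1 from ⟨hx, hx1⟩)]
      · rw [Set.indicator_of_notMem (fun h => hx1 h.2),
          ENNReal.ofReal_of_nonpos (by linarith)]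
    · have : Prod.mk x ⁻¹' {u : ℝ × ℝ | 0 ≤ u.1 ∧ 0 ≤ u.2 ∧ u.1 + u.2 ≤ 1} = ∅ := by
        ext y
        simp [hx]
      rw [this, measure_empty, Set.indicator_of_notMem (fun h => hx h.1)]
  rw [Measure.volume_eq_prod, Measure.prod_apply hclosed.measurableSet]
  simp_rw [hslice]
  rw [lintegral_indicator measurableSet_Icc, ← ofReal_integral_eq_lintegral_ofReal]
  · congr 1
    rw [integral_Icc_eq_integral_Ioc, ← intervalIntegral.integral_of_le zero_le_one,
      intervalIntegral.integral_sub intervalIntegrable_const intervalIntegral.intervalIntegrable_id]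
    norm_num
  · exact (by fun_prop : Continuous fun t : ℝ => 1 - t).continuousOn.integrableOn_Icc
  · filter_upwards [ae_restrict_mem measurableSet_Icc] with t ht
    simpa using ht.2

lemma convexHull_triangle_eq_image (p q r : ℝ × ℝ) :
    convexHull ℝ {p, q, r} =
      (fun u => p + u) '' (Matrix.toLin (Module.Basis.finTwoProd ℝ) (Module.Basis.finTwoProd ℝ)
        !![q.1 - p.1, r.1 - p.1; q.2 - p.2, r.2 - p.2] ''
          {u : ℝ × ℝ | 0 ≤ u.1 ∧ 0 ≤ u.2 ∧ u.1 + u.2 ≤ 1}) := by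
  rw [Matrix.toLin_finTwoProd]
  apply Set.Subset.antisymm
  · apply convexHull_min
    · rintro x (rfl | rfl | rfl)
      · exact ⟨_, ⟨(0, 0), by norm_num, rfl⟩, by ext <;> simp⟩
      · exact ⟨_, ⟨(1, 0), by norm_num, rfl⟩, by ext <;> simp⟩
      · exact ⟨_, ⟨(0, 1), by norm_num, rfl⟩, by ext <;> simp⟩
    · have hU : Convex ℝ {u : ℝ × ℝ | 0 ≤ u.1 ∧ 0 ≤ u.2 ∧ u.1 + u.2 ≤ 1} := by
        rintro ⟨a, b⟩ ⟨ha, hb, hab⟩ ⟨c, d⟩ ⟨hc, hd, hcd⟩ s t hs ht hst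
        simp only [Set.mem_ofPred_eq, Prod.smul_mk, Prod.mk_add_mk, smul_eq_mul] at *
        refine ⟨by positivity, by positivity, ?_⟩
        nlinarith
      exact (hU.linear_image _).translate p
  · rintro _ ⟨_, ⟨⟨x, y⟩, ⟨hx, hy, hxy⟩, rfl⟩, rfl⟩
    simp only at hx hy hxy
    have h := (convex_convexHull ℝ {p, q, r}).sum_mem (t := Finset.univ)
      (w := ![1 - x - y, x, y]) (z := ![p, q, r])
      (by intro i _; fin_cases i <;> simp <;> linarith)
      (by simp only [Fin.sum_univ_three, Matrix.cons_val]; ring)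
      (by intro i _; apply subset_convexHull; fin_cases i <;> simp)
    convert h using 1
    ext <;> simp [Fin.sum_univ_three] <;> ring

lemma volume_real_convexHull_triangle (p q r : ℝ × ℝ) :
    volume.real (convexHull ℝ {p, q, r}) = |planeDet p q r| / 2 := by
  rw [convexHull_triangle_eq_image, Measure.real, Set.image_add_left, measure_preimage_add,
    Measure.addHaar_image_linearMap, volume_unit_triangle, LinearMap.det_toLin,
    ← ENNReal.ofReal_mul (abs_nonneg _), ENNReal.toReal_ofReal (by positivity),
    Matrix.det_fin_two_of, planeDet]
  ring_nf

lemma volume_planeDet_eq_zero {p q : ℝ × ℝ} (h : p ≠ q) :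
    volume {u | planeDet p q u = 0} = 0 := by
  let f : ℝ × ℝ →ₗ[ℝ] ℝ :=
    (q.1 - p.1) • LinearMap.snd ℝ ℝ ℝ - (q.2 - p.2) • LinearMap.fst ℝ ℝ ℝ
  have hset : {u | planeDet p q u = 0} =
      (fun u => -p + u) ⁻¹' (LinearMap.ker f : Set (ℝ × ℝ)) := by
    ext u
    simp only [planeDet, Set.mem_ofPred_eq, Set.mem_preimage, SetLike.mem_coe, LinearMap.mem_ker,
      f, LinearMap.sub_apply, LinearMap.smul_apply, LinearMap.snd_apply, LinearMap.fst_apply,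
      Prod.fst_add, Prod.snd_add, Prod.fst_neg, Prod.snd_neg, smul_eq_mul]
    ring_nf
  rw [hset, measure_preimage_add]
  apply Measure.addHaar_submodule
  rw [Ne, LinearMap.ker_eq_top]
  intro hf
  have h1 := LinearMap.congr_fun hf (0, 1)
  have h2 := LinearMap.congr_fun hf (1, 0)
  simp [f] at h1 h2
  exact h (Prod.ext (by linarith) (by linarith))

lemma mem_segment_of_planeDet_eq_zero {p q z : ℝ × ℝ} (hpq : p ≠ q)
    (hp : p.1 ^ 2 + p.2 ^ 2 = 1) (hq : q.1 ^ 2 + q.2 ^ 2 = 1) (hz : z.1 ^ 2 + z.2 ^ 2 ≤ 1)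
    (h : planeDet p q z = 0) : z ∈ segment ℝ p q := by
  have hD : 0 < (q.1 - p.1) ^ 2 + (q.2 - p.2) ^ 2 := by
    by_contra hn
    apply hpq
    ext <;> nlinarith [sq_nonneg (q.1 - p.1), sq_nonneg (q.2 - p.2)]
  set D := (q.1 - p.1) ^ 2 + (q.2 - p.2) ^ 2 with hDdef
  set τ := ((q.1 - p.1) * (z.1 - p.1) + (q.2 - p.2) * (z.2 - p.2)) / D with hτ
  have hτD : τ * D = (q.1 - p.1) * (z.1 - p.1) + (q.2 - p.2) * (z.2 - p.2) := by
    rw [hτ]; field_simp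
  unfold planeDet at h
  have e1 : z.1 = p.1 + τ * (q.1 - p.1) := by
    have : (z.1 - p.1 - τ * (q.1 - p.1)) * D = 0 := by
      linear_combination (-(q.2 - p.2)) * h - (q.1 - p.1) * hτD + (z.1 - p.1) * hDdef
    rcases mul_eq_zero.1 this with h0 | h0
    · linarith
    · exact absurd h0 hD.ne'
  have e2 : z.2 = p.2 + τ * (q.2 - p.2) := by
    have : (z.2 - p.2 - τ * (q.2 - p.2)) * D = 0 := by
      linear_combination ((q.1 - p.1)) * h - (q.2 - p.2) * hτD + (z.2 - p.2) * hDdef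
    rcases mul_eq_zero.1 this with h0 | h0
    · linarith
    · exact absurd h0 hD.ne'
  have hle : τ * (τ - 1) * D ≤ 0 := by
    rw [e1, e2] at hz
    have : τ * (τ - 1) * D = (p.1 + τ * (q.1 - p.1)) ^ 2 + (p.2 + τ * (q.2 - p.2)) ^ 2 - 1 := by
      linear_combination τ * (τ - 1) * hDdef - (1 - τ) * hp - τ * hq
    linarith
  have hle' : τ * (τ - 1) ≤ 0 := by
    by_contra hn
    nlinarith [mul_pos (not_le.1 hn) hD]
  have h0 : 0 ≤ τ := by nlinarith
  have h1 : τ ≤ 1 := by nlinarith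
  refine ⟨1 - τ, τ, by linarith, h0, by ring, ?_⟩
  ext
  · simp; linarith
  · simp; linarith

lemma convexHull_insert_eq_union {K : Set (ℝ × ℝ)} {p q v : ℝ × ℝ} (hp : p ∈ K) (hq : q ∈ K)
    (hpq : p ≠ q) (hK : ∀ u ∈ K, u.1 ^ 2 + u.2 ^ 2 = 1) (hv : v.1 ^ 2 + v.2 ^ 2 = 1)
    (hKdet : ∀ u ∈ K, planeDet p q u ≤ 0) (hvdet : 0 < planeDet p q v) :
    convexHull ℝ (insert v K) = convexHull ℝ K ∪ convexHull ℝ {p, q, v} ∧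
      (∀ u ∈ convexHull ℝ K, planeDet p q u ≤ 0) ∧
      (∀ u ∈ convexHull ℝ {p, q, v}, 0 ≤ planeDet p q u) := by
  have hcomb : ∀ (x y : ℝ × ℝ) (a b : ℝ), a + b = 1 →
      planeDet p q (a • x + b • y) = a * planeDet p q x + b * planeDet p q y := by
    intro x y a b hab
    obtain rfl : a = 1 - b := by linarith
    simp only [planeDet, Prod.fst_add, Prod.snd_add, Prod.smul_fst, Prod.smul_snd, smul_eq_mul]
    ring
  have hneg : Convex ℝ {u | planeDet p q u ≤ 0} := by
    intro x hx y hy a b ha hb hab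
    simp only [Set.mem_ofPred_eq] at *
    rw [hcomb _ _ _ _ hab]
    nlinarith
  have hpos : Convex ℝ {u | 0 ≤ planeDet p q u} := by
    intro x hx y hy a b ha hb hab
    simp only [Set.mem_ofPred_eq] at *
    rw [hcomb _ _ _ _ hab]
    positivity
  have hdisc : Convex ℝ {u : ℝ × ℝ | u.1 ^ 2 + u.2 ^ 2 ≤ 1} := by
    intro x hx y hy a b ha hb hab
    simp only [Set.mem_ofPred_eq, Prod.fst_add, Prod.snd_add, Prod.smul_fst, Prod.smul_snd,
      smul_eq_mul] at *
    obtain rfl : a = 1 - b := by linarith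
    nlinarith [mul_nonneg (mul_nonneg ha hb) (add_nonneg (sq_nonneg (x.1 - y.1))
      (sq_nonneg (x.2 - y.2)))]
  have hKneg : ∀ u ∈ convexHull ℝ K, planeDet p q u ≤ 0 := fun u hu =>
    convexHull_min (show K ⊆ {u | planeDet p q u ≤ 0} from hKdet) hneg hu
  have hp0 : planeDet p q p = 0 := by simp [planeDet]
  have hq0 : planeDet p q q = 0 := by simp only [planeDet]; ring
  refine ⟨Set.Subset.antisymm ?_ ?_, hKneg, fun u hu => ?_⟩
  · rw [convexHull_insert ⟨p, hp⟩]
    intro x hx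
    rw [mem_convexJoin] at hx
    obtain ⟨v', hv', w, hw, a, b, ha, hb, hab, rfl⟩ := hx
    rw [Set.mem_singleton_iff.1 hv']
    have hwneg := hKneg w hw
    set s := planeDet p q v
    set r := planeDet p q w
    have hsr : 0 < s - r := by linarith
    let t := s / (s - r)
    have ht0 : 0 < t := div_pos hvdet hsr
    have ht1 : t ≤ 1 := (div_le_one hsr).2 (by linarith)
    let z := (1 - t) • v + t • w
    have hzdet : planeDet p q z = 0 := by
      rw [hcomb _ _ _ _ (by ring)]
      have : t * (s - r) = s := div_mul_cancel₀ _ hsr.ne'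
      change (1 - t) * s + t * r = 0
      linarith
    have hzdisc : z ∈ {u : ℝ × ℝ | u.1 ^ 2 + u.2 ^ 2 ≤ 1} :=
      hdisc hv.le (convexHull_min (fun u hu => (hK u hu).le) hdisc hw) (sub_nonneg.2 ht1) ht0.le
        (sub_add_cancel 1 t)
    have hzseg : z ∈ segment ℝ p q :=
      mem_segment_of_planeDet_eq_zero hpq (hK p hp) (hK q hq) hzdisc hzdet
    obtain rfl : a = 1 - b := by linarith
    rcases le_total b t with hbt | hbt
    · right
      have hztri : z ∈ convexHull ℝ {p, q, v} :=
        segment_subset_convexHull (by simp) (by simp) hzseg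
      have hvtri : v ∈ convexHull ℝ {p, q, v} := subset_convexHull _ _ (by simp)
      have := convex_convexHull ℝ {p, q, v} hvtri hztri
        (a := 1 - b / t) (b := b / t) (by rw [sub_nonneg, div_le_one ht0]; exact hbt)
        (by positivity) (by ring)
      convert this using 1
      simp only [z, smul_add, smul_smul, ← add_assoc, ← add_smul]
      congr 2
      · field_simp; ring
      · field_simp
    · left
      have hzK : z ∈ convexHull ℝ K := segment_subset_convexHull hp hq hzseg
      rcases eq_or_lt_of_le ht1 with h1 | h1
      · have : b = 1 := by linarith
        subst this
        simpa using hw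
      · have h1' : 0 < 1 - t := by linarith
        have := convex_convexHull ℝ K hzK hw
          (a := (1 - b) / (1 - t)) (b := 1 - (1 - b) / (1 - t)) (by positivity)
          (by rw [sub_nonneg, div_le_one h1']; linarith) (by ring)
        convert this using 1
        simp only [z, smul_add, smul_smul, add_assoc, ← add_smul]
        congr 2
        · field_simp
        · field_simp; ring
  · apply Set.union_subset
    · exact convexHull_mono (Set.subset_insert _ _)
    · apply convexHull_mono
      rintro x (rfl | rfl | rfl)
      · exact Or.inr hp
      · exact Or.inr hq
      · exact Or.inl rfl
  · refine convexHull_min ?_ hpos hu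
    rintro x (rfl | rfl | rfl)
    · exact hp0.ge
    · exact hq0.ge
    · exact hvdet.le

lemma sin_add_sin_add_sin (x y z : ℝ) :
    Real.sin (y - x) + Real.sin (z - y) + Real.sin (x - z) =
      4 * Real.sin ((y - x) / 2) * Real.sin ((z - y) / 2) * Real.sin ((z - x) / 2) := by
  obtain ⟨a, ha⟩ : ∃ a, a = (y - x) / 2 := ⟨_, rfl⟩
  obtain ⟨b, hb⟩ : ∃ b, b = (z - y) / 2 := ⟨_, rfl⟩
  rw [show y - x = 2 * a by linarith, show z - y = 2 * b by linarith,
    show x - z = -(2 * a + 2 * b) by linarith, show (z - x) / 2 = a + b by linarith,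
    show 2 * a / 2 = a by ring, show 2 * b / 2 = b by ring, Real.sin_neg, Real.sin_add (2 * a),
    Real.sin_add a, Real.sin_two_mul, Real.sin_two_mul, Real.cos_two_mul', Real.cos_two_mul']
  have h1 := Real.sin_sq_add_cos_sq a
  have h2 := Real.sin_sq_add_cos_sq b
  have e1 : Real.cos a ^ 2 = 1 - Real.sin a ^ 2 := by linarith
  have e2 : Real.cos b ^ 2 = 1 - Real.sin b ^ 2 := by linarith
  rw [e1, e2]
  ring

lemma planeDet_pt (x y z : ℝ) :
    planeDet (pt x) (pt y) (pt z) =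
      Real.sin (y - x) + Real.sin (z - y) + Real.sin (x - z) := by
  simp only [planeDet, pt, Real.sin_sub]
  ring

/-- Adding a last point, in angular order, to a polygon inscribed in the unit circle. -/
lemma volume_real_convexHull_insert_pt {S : Set ℝ} (hS : S.Finite) {x y z : ℝ} (hx : x ∈ S)
    (hy : y ∈ S) (hxS : ∀ s ∈ S, x ≤ s) (hyS : ∀ s ∈ S, s ≤ y) (hyz : y < z)
    (hzx : z < x + 2 * Real.pi) :
    volume.real (convexHull ℝ (pt '' insert z S)) = volume.real (convexHull ℝ (pt '' S)) +
      (Real.sin (y - x) + Real.sin (z - y) + Real.sin (x - z)) / 2 := by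
  have hcirc : ∀ t, (pt t).1 ^ 2 + (pt t).2 ^ 2 = 1 := fun t => Real.cos_sq_add_sin_sq t
  rw [Set.image_insert_eq]
  rcases (hxS y hy).eq_or_lt with rfl | hxy
  · have hSx : S = {x} := by
      ext s
      exact ⟨fun h => le_antisymm (hyS s h) (hxS s h), fun h => h ▸ hx⟩
    have htri : ({pt z, pt x} : Set (ℝ × ℝ)) = {pt x, pt x, pt z} := by
      ext; simp [or_comm]
    rw [hSx, Set.image_singleton, htri, volume_real_convexHull_triangle, planeDet_pt,
      convexHull_singleton]
    have : Real.sin (x - z) = -Real.sin (z - x) := by rw [← Real.sin_neg]; ring_nf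
    simp [this, Measure.real]
  · have sinpos : ∀ a b : ℝ, a < b → b < a + 2 * Real.pi → 0 < Real.sin ((b - a) / 2) := by
      intro a b h1 h2
      exact Real.sin_pos_of_pos_of_lt_pi (by linarith) (by linarith)
    have hdet : 0 < planeDet (pt x) (pt y) (pt z) := by
      rw [planeDet_pt, sin_add_sin_add_sin]
      have := sinpos x y hxy (by linarith)
      have := sinpos y z hyz (by linarith)
      have := sinpos x z (by linarith) (by linarith)
      positivity
    have hpq : pt x ≠ pt y := by
      intro h
      rw [h] at hdet
      simp [planeDet] at hdet
    have hKdet : ∀ u ∈ pt '' S, planeDet (pt x) (pt y) u ≤ 0 := by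
      rintro _ ⟨s, hs, rfl⟩
      rw [planeDet_pt, sin_add_sin_add_sin]
      have h1 := sinpos x y hxy (by linarith)
      have h2 : 0 ≤ Real.sin ((s - x) / 2) := by
        have := hxS s hs
        have := hyS s hs
        exact Real.sin_nonneg_of_nonneg_of_le_pi (by linarith) (by linarith)
      have h3 : 0 ≤ Real.sin ((y - s) / 2) := by
        have := hxS s hs
        have := hyS s hs
        exact Real.sin_nonneg_of_nonneg_of_le_pi (by linarith) (by linarith)
      have h4 : Real.sin ((s - y) / 2) = -Real.sin ((y - s) / 2) := by
        rw [← Real.sin_neg]; ring_nf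
      rw [h4]
      have : 0 ≤ 4 * Real.sin ((y - x) / 2) * Real.sin ((y - s) / 2) * Real.sin ((s - x) / 2) := by
        positivity
      linarith
    obtain ⟨hunion, hneg, hpos⟩ := convexHull_insert_eq_union (Set.mem_image_of_mem pt hx)
      (Set.mem_image_of_mem pt hy) hpq (by rintro _ ⟨s, -, rfl⟩; exact hcirc s) (hcirc z)
      hKdet hdet
    have hfin : (pt '' S).Finite := hS.image _
    have hfin3 : ({pt x, pt y, pt z} : Set (ℝ × ℝ)).Finite := Set.toFinite _
    rw [hunion, measureReal_union₀ (hfin3.isClosed_convexHull (𝕜 := ℝ)).measurableSet.nullMeasurableSet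
      (measure_mono_null (fun u hu => le_antisymm (hneg u hu.1) (hpos u hu.2))
        (volume_planeDet_eq_zero hpq))
      (hfin.isCompact_convexHull (𝕜 := ℝ)).measure_ne_top
      (hfin3.isCompact_convexHull (𝕜 := ℝ)).measure_ne_top,
      volume_real_convexHull_triangle, abs_of_pos hdet, planeDet_pt]

/-- The last index before `m` satisfying `P`, or `0` if there is none. -/
def lastBefore (P : ℕ → Bool) : ℕ → ℕ
  | 0 => 0
  | k + 1 => if P k then k else lastBefore P k

/-- The indices at which a two-colouring changes colour. -/
def changes (C : ℕ → Bool) (m : ℕ) : Bool := C m != C (m + 1)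

/-- The contribution to the area of a polygon of the arc which ends at the index `m + 1` and starts
at the previous index of the same colour, for the colourings whose colour changes are given
by `B`. -/
noncomputable def gapTerm (T : ℕ → ℝ) (B : ℕ → Bool) (m : ℕ) : ℝ :=
  Real.sin (T (m + 1) - T (if B m then lastBefore B m else m))

lemma lastBefore_succ (P : ℕ → Bool) (k : ℕ) :
    lastBefore P (k + 1) = if P k then k else lastBefore P k := rfl

lemma lastBefore_le (P : ℕ → Bool) (m : ℕ) : lastBefore P m ≤ m := by
  induction m with
  | zero => simp [lastBefore]
  | succ k ih => rw [lastBefore_succ]; split <;> omega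

lemma lastBefore_lt (P : ℕ → Bool) {m : ℕ} (hm : 0 < m) : lastBefore P m < m := by
  obtain ⟨k, rfl⟩ : ∃ k, m = k + 1 := ⟨m - 1, by omega⟩
  have := lastBefore_le P k
  rw [lastBefore_succ]; split <;> omega

lemma le_lastBefore {P : ℕ → Bool} {j m : ℕ} (hj : P j) (hjm : j < m) : j ≤ lastBefore P m := by
  induction m with
  | zero => omega
  | succ k ih =>
    rw [lastBefore_succ]
    split
    · omega
    · rename_i h
      rcases Nat.lt_succ_iff_lt_or_eq.1 hjm with h' | rfl
      · exact ih h'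
      · exact absurd hj h

lemma lastBefore_spec {P : ℕ → Bool} {j m : ℕ} (hj : P j) (hjm : j < m) : P (lastBefore P m) := by
  induction m with
  | zero => omega
  | succ k ih =>
    rw [lastBefore_succ]
    split
    · assumption
    · rename_i h
      rcases Nat.lt_succ_iff_lt_or_eq.1 hjm with h' | rfl
      · exact ih h'
      · exact absurd hj h

lemma lastBefore_mono {P Q : ℕ → Bool} (h : ∀ m, P m → Q m) (m : ℕ) :
    lastBefore P m ≤ lastBefore Q m := by
  induction m with
  | zero => simp [lastBefore]
  | succ k ih =>
    rw [lastBefore_succ, lastBefore_succ]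
    by_cases hP : P k
    · simp [hP, h k hP]
    · have := lastBefore_le P k
      by_cases hQ : Q k
      · simpa [hP, hQ] using this
      · simpa [hP, hQ] using ih

lemma lastBefore_add {P : ℕ → Bool} {N : ℕ} (hP : ∀ m, P (m + N) = P m) {j m : ℕ} (hj : P j)
    (hjm : j < m) : lastBefore P (m + N) = lastBefore P m + N := by
  induction m with
  | zero => omega
  | succ k ih =>
    rw [show k + 1 + N = (k + N) + 1 by ring, lastBefore_succ, lastBefore_succ, hP]
    by_cases h : P k
    · simp [h]
    · simp only [h]
      rcases Nat.lt_succ_iff_lt_or_eq.1 hjm with h' | rfl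
      · simpa using ih h'
      · exact absurd hj h

lemma lastBefore_ne_eq_lastBefore_changes (C : ℕ → Bool) (m : ℕ) :
    lastBefore (fun j => C j != C m) m = lastBefore (changes C) m := by
  induction m with
  | zero => rfl
  | succ k ih =>
    rw [lastBefore_succ, lastBefore_succ, ← ih]
    by_cases h : C k = C (k + 1)
    · simp [changes, h]
    · simp [changes, h]

lemma sin_sub_lastBefore_eq_gapTerm (T : ℕ → ℝ) {C : ℕ → Bool} {m : ℕ} (hm : C (m + 1)) :
    Real.sin (T (m + 1) - T (lastBefore C (m + 1))) = gapTerm T (changes C) m := by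
  rw [gapTerm, lastBefore_succ]
  by_cases h : C m
  · simp [changes, h, hm]
  · have hC : C = fun j => C j != C m := by
      ext j; simp [h]
    rw [← lastBefore_ne_eq_lastBefore_changes, ← hC]
    simp [changes, h, hm]

lemma sum_range_add_of_periodic {w : ℕ → ℝ} {N : ℕ} (hw : ∀ m, w (m + N) = w m) (a : ℕ) :
    ∑ k ∈ Finset.range N, w (a + k) = ∑ k ∈ Finset.range N, w k := by
  induction a with
  | zero => simp
  | succ a ih =>
    rw [← ih]
    have h1 := Finset.sum_range_succ (fun k => w (a + k)) N
    have h2 := Finset.sum_range_succ' (fun k => w (a + k)) N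
    have h3 := hw a
    simp only [add_zero] at h2
    have h4 : ∀ k, w (a + 1 + k) = w (a + (k + 1)) := fun k => by congr 1; ring
    simp only [h4]
    linarith

lemma volume_real_arc {T : ℕ → ℝ} (hT : StrictMono T) {P : ℕ → Bool} {a : ℕ} (ha : P a) (L : ℕ)
    (hL : T (a + L) < T a + 2 * Real.pi) :
    volume.real (convexHull ℝ (pt '' (T '' {m | a ≤ m ∧ m ≤ a + L ∧ P m}))) =
      ((∑ k ∈ Finset.range L, if P (a + k + 1) then
          Real.sin (T (a + k + 1) - T (lastBefore P (a + k + 1))) else 0) +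
        Real.sin (T a - T (lastBefore P (a + L + 1)))) / 2 := by
  induction L with
  | zero =>
    have : {m | a ≤ m ∧ m ≤ a + 0 ∧ P m} = {a} := by
      ext m
      simp only [Set.mem_ofPred_eq, Set.mem_singleton_iff]
      constructor
      · rintro ⟨h1, h2, -⟩; omega
      · rintro rfl; simp [ha]
    rw [this]
    simp [lastBefore_succ, ha, Measure.real]
  | succ L ih =>
    have hL' : T (a + L) < T a + 2 * Real.pi := (hT (by omega)).trans hL
    specialize ih hL'
    rw [Finset.sum_range_succ]
    by_cases hP : P (a + L + 1)
    · have hset : {m | a ≤ m ∧ m ≤ a + (L + 1) ∧ P m} =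
          insert (a + L + 1) {m | a ≤ m ∧ m ≤ a + L ∧ P m} := by
        ext m
        simp only [Set.mem_ofPred_eq, Set.mem_insert_iff]
        constructor
        · rintro ⟨h1, h2, h3⟩
          rcases eq_or_ne m (a + L + 1) with h | h
          · exact Or.inl h
          · exact Or.inr ⟨h1, by omega, h3⟩
        · rintro (rfl | ⟨h1, h2, h3⟩)
          · exact ⟨by omega, by omega, hP⟩
          · exact ⟨h1, by omega, h3⟩
      have hal : a < a + L + 1 := by omega
      have hlast := lastBefore_spec ha hal
      have hlast1 := le_lastBefore ha hal
      have hlast2 := lastBefore_lt P (show 0 < a + L + 1 by omega)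
      have hfin : {m | a ≤ m ∧ m ≤ a + L ∧ P m}.Finite :=
        (Set.finite_Icc a (a + L)).subset fun m hm => ⟨hm.1, hm.2.1⟩
      rw [hset, Set.image_insert_eq, volume_real_convexHull_insert_pt (hfin.image T)
        (x := T a) (y := T (lastBefore P (a + L + 1))) ⟨a, ⟨le_rfl, by omega, ha⟩, rfl⟩
        ⟨_, ⟨hlast1, by omega, hlast⟩, rfl⟩
        (by rintro _ ⟨m, hm, rfl⟩; exact hT.monotone hm.1)
        (by
          rintro _ ⟨m, hm, rfl⟩
          exact hT.monotone (le_lastBefore hm.2.2 (by have := hm.2.1; omega)))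
        (hT hlast2) hL, ih]
      have hneg : Real.sin (T (lastBefore P (a + L + 1)) - T a) =
          -Real.sin (T a - T (lastBefore P (a + L + 1))) := by
        rw [← Real.sin_neg]; ring_nf
      rw [show a + (L + 1) + 1 = (a + L + 1) + 1 by ring, lastBefore_succ P (a + L + 1), hneg]
      simp only [hP, if_true]
      ring
    · have hset : {m | a ≤ m ∧ m ≤ a + (L + 1) ∧ P m} = {m | a ≤ m ∧ m ≤ a + L ∧ P m} := by
        ext m
        simp only [Set.mem_ofPred_eq]
        constructor
        · rintro ⟨h1, h2, h3⟩
          refine ⟨h1, ?_, h3⟩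
          rcases eq_or_ne m (a + L + 1) with rfl | h
          · exact absurd h3 hP
          · omega
        · rintro ⟨h1, h2, h3⟩
          exact ⟨h1, by omega, h3⟩
      rw [hset, ih, show a + (L + 1) + 1 = (a + L + 1) + 1 by ring, lastBefore_succ P (a + L + 1)]
      simp [hP]

lemma changes_add {C : ℕ → Bool} {n : ℕ} (hC : ∀ m, C (m + n) = !C m) (m : ℕ) :
    changes C (m + n) = changes C m := by
  rw [changes, changes, hC, show m + n + 1 = (m + 1) + n by ring, hC]
  cases C m <;> cases C (m + 1) <;> rfl

lemma exists_changes {C : ℕ → Bool} {n : ℕ} (hC : ∀ m, C (m + n) = !C m) :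
    ∃ i < n, changes C i := by
  by_contra! h
  have : ∀ m ≤ n, C m = C 0 := by
    intro m
    induction m with
    | zero => simp
    | succ k ih =>
      intro hk
      have := h k (by omega)
      simp only [changes, bne_iff_ne, ne_eq, not_not] at this
      rw [← this, ih (by omega)]
  have h1 := this n le_rfl
  have h2 := hC 0
  rw [zero_add, h1] at h2
  cases h3 : C 0 <;> simp [h3] at h2

lemma gapTerm_add {T : ℕ → ℝ} {n : ℕ} (hTn : ∀ m, T (m + n) = T m + Real.pi) {B : ℕ → Bool}
    (hB : ∀ m, B (m + n) = B m) {i : ℕ} (hi : B i) {m : ℕ} (him : i < m) :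
    gapTerm T B (m + n) = gapTerm T B m := by
  rw [gapTerm, gapTerm, hB, show m + n + 1 = (m + 1) + n by ring, hTn]
  by_cases h : B m
  · simp only [h, if_true, lastBefore_add hB hi him, hTn, add_sub_add_right_eq_sub]
  · simp only [h, Bool.false_eq_true, if_false, hTn, add_sub_add_right_eq_sub]

/-- The area of an antipodal polygon in terms of the colour changes. -/
lemma volume_real_polygon {T : ℕ → ℝ} (hT : StrictMono T) {n : ℕ} (hn : 0 < n)
    (hTn : ∀ m, T (m + n) = T m + Real.pi) {C : ℕ → Bool} (hC : ∀ m, C (m + n) = !C m)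
    {a : ℕ} (han : n ≤ a) (ha : C a) :
    volume.real (convexHull ℝ (pt '' (T '' {m | a ≤ m ∧ m < a + 2 * n ∧ C m}))) =
      (∑ k ∈ Finset.range n, gapTerm T (changes C) (n + k)) / 2 := by
  have hT2 : ∀ m, T (m + 2 * n) = T m + 2 * Real.pi := by
    intro m
    rw [show m + 2 * n = m + n + n by ring, hTn, hTn]; ring
  have hC2 : ∀ m, C (m + 2 * n) = C m := by
    intro m
    rw [show m + 2 * n = m + n + n by ring, hC, hC, Bool.not_not]
  obtain ⟨i, hin, hi⟩ := exists_changes hC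
  have hB := changes_add hC
  obtain ⟨L, hL⟩ : ∃ L, 2 * n = L + 1 := ⟨2 * n - 1, by omega⟩
  have hset : {m | a ≤ m ∧ m < a + 2 * n ∧ C m} = {m | a ≤ m ∧ m ≤ a + L ∧ C m} := by
    ext m
    simp only [Set.mem_ofPred_eq, hL, ← add_assoc, Nat.lt_succ_iff]
  rw [hset, volume_real_arc hT ha L (by rw [← hT2]; exact hT (by omega))]
  have hclose : Real.sin (T a - T (lastBefore C (a + L + 1))) =
      if C (a + L + 1) then Real.sin (T (a + L + 1) - T (lastBefore C (a + L + 1))) else 0 := by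
    have e : a + L + 1 = a + 2 * n := by omega
    have ha' : C (a + L + 1) := by rw [e, hC2, ha]
    have hTa : T (a + L + 1) = T a + 2 * Real.pi := by rw [e, hT2]
    rw [if_pos ha', hTa, show T a + 2 * Real.pi - T (lastBefore C (a + L + 1)) =
      T a - T (lastBefore C (a + L + 1)) + 2 * Real.pi by ring, Real.sin_add_two_pi]
  rw [hclose, ← Finset.sum_range_succ (fun k => if C (a + k + 1) then
    Real.sin (T (a + k + 1) - T (lastBefore C (a + k + 1))) else 0) L, ← hL]
  congr 1
  let w : ℕ → ℝ := fun k => if C (n + k + 1) then gapTerm T (changes C) (n + k) else 0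
  have hw : ∀ m, w (m + 2 * n) = w m := by
    intro m
    simp only [w]
    rw [show n + (m + 2 * n) + 1 = n + m + 1 + 2 * n by ring, hC2,
      show n + (m + 2 * n) = n + m + n + n by ring, gapTerm_add hTn hB hi (by omega),
      gapTerm_add hTn hB hi (by omega)]
  calc _ = ∑ k ∈ Finset.range (2 * n), w ((a - n) + k) := by
        refine Finset.sum_congr rfl fun k _ => ?_
        simp only [w]
        rw [show n + (a - n + k) = a + k by omega]
        split
        · exact sin_sub_lastBefore_eq_gapTerm T (by assumption)
        · rfl
    _ = ∑ k ∈ Finset.range (2 * n), w k := sum_range_add_of_periodic hw _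
    _ = ∑ k ∈ Finset.range n, (w k + w (n + k)) := by
        rw [two_mul, Finset.sum_range_add, Finset.sum_add_distrib]
    _ = _ := by
        refine Finset.sum_congr rfl fun k _ => ?_
        simp only [w]
        rw [show n + (n + k) + 1 = n + k + 1 + n by ring, hC,
          show n + (n + k) = n + k + n by ring, gapTerm_add hTn hB hi (by omega)]
        cases C (n + k + 1) <;> simp

lemma sin_four_point (p q r t : ℝ) :
    Real.sin (t - q) + Real.sin (r - p) - (Real.sin (t - p) + Real.sin (r - q)) =
      4 * Real.sin ((q - p) / 2) * Real.sin ((t - r) / 2) * Real.sin ((t - q + (r - p)) / 2) := by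
  have h1 : Real.sin (t - q) - Real.sin (t - p) =
      2 * Real.sin ((p - q) / 2) * Real.cos (t - (p + q) / 2) := by
    rw [Real.sin_sub_sin]; ring_nf
  have h2 : Real.sin (r - p) - Real.sin (r - q) =
      2 * Real.sin ((q - p) / 2) * Real.cos (r - (p + q) / 2) := by
    rw [Real.sin_sub_sin]; ring_nf
  have h3 : Real.cos (r - (p + q) / 2) - Real.cos (t - (p + q) / 2) =
      2 * Real.sin ((t - r) / 2) * Real.sin ((t - q + (r - p)) / 2) := by
    rw [Real.cos_sub_cos, show (r - (p + q) / 2 - (t - (p + q) / 2)) / 2 = -((t - r) / 2) by ring,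
      Real.sin_neg]
    ring_nf
  have h4 : Real.sin ((p - q) / 2) = -Real.sin ((q - p) / 2) := by
    rw [← Real.sin_neg]; ring_nf
  rw [h4] at h1
  linear_combination h1 + h2 + 2 * Real.sin ((q - p) / 2) * h3

lemma sin_four_point_lt {p q r t : ℝ} (hpq : p < q) (hqr : q ≤ r) (hrt : r < t)
    (h : t - q + (r - p) < 2 * Real.pi) :
    Real.sin (t - p) + Real.sin (r - q) < Real.sin (t - q) + Real.sin (r - p) := by
  have h1 : 0 < Real.sin ((q - p) / 2) :=
    Real.sin_pos_of_pos_of_lt_pi (by linarith) (by linarith)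
  have h2 : 0 < Real.sin ((t - r) / 2) :=
    Real.sin_pos_of_pos_of_lt_pi (by linarith) (by linarith)
  have h3 : 0 < Real.sin ((t - q + (r - p)) / 2) :=
    Real.sin_pos_of_pos_of_lt_pi (by linarith) (by linarith)
  have := sin_four_point p q r t
  have h4 : 0 < 4 * Real.sin ((q - p) / 2) * Real.sin ((t - r) / 2) *
    Real.sin ((t - q + (r - p)) / 2) := by positivity
  linarith

lemma sin_four_point_le {p q r t : ℝ} (hpq : p ≤ q) (hqr : q ≤ r) (hrt : r ≤ t)
    (h : t - q + (r - p) ≤ 2 * Real.pi) :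
    Real.sin (t - p) + Real.sin (r - q) ≤ Real.sin (t - q) + Real.sin (r - p) := by
  have h1 : 0 ≤ Real.sin ((q - p) / 2) :=
    Real.sin_nonneg_of_nonneg_of_le_pi (by linarith) (by linarith)
  have h2 : 0 ≤ Real.sin ((t - r) / 2) :=
    Real.sin_nonneg_of_nonneg_of_le_pi (by linarith) (by linarith)
  have h3 : 0 ≤ Real.sin ((t - q + (r - p)) / 2) :=
    Real.sin_nonneg_of_nonneg_of_le_pi (by linarith) (by linarith)
  have := sin_four_point p q r t
  have h4 : 0 ≤ 4 * Real.sin ((q - p) / 2) * Real.sin ((t - r) / 2) *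
    Real.sin ((t - q + (r - p)) / 2) := by positivity
  linarith

/-- Adding colour changes strictly increases the area. -/
lemma sum_gapTerm_lt {T : ℕ → ℝ} (hT : StrictMono T) {n : ℕ} (hn : 3 ≤ n)
    (hTn : ∀ m, T (m + n) = T m + Real.pi) {B B' : ℕ → Bool} (hB : ∀ m, B (m + n) = B m)
    (hB' : ∀ m, B' (m + n) = B' m) (hle : ∀ m, B m → B' m) {i : ℕ} (hin : i < n) (hi : B i)
    {d : ℕ} (hdn : d < n) (hdB : ¬ B d) (hdB' : B' d) :
    ∑ k ∈ Finset.range n, gapTerm T B (n + k) < ∑ k ∈ Finset.range n, gapTerm T B' (n + k) := by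
  let Φ : (ℕ → Bool) → ℕ → ℝ := fun A m => Real.sin (T (m + 1) - T (lastBefore A m))
  let Ψ : ℕ → ℝ := fun k => Φ B (n + k) - Φ B' (n + k)
  have hex : ∀ m, n ≤ m → ∃ j, m ≤ j + n ∧ j < m ∧ B j := by
    intro m hm
    induction m, hm using Nat.le_induction with
    | base => exact ⟨i, by omega, hin, hi⟩
    | succ m hm ih =>
      obtain ⟨j, h1, h2, h3⟩ := ih
      rcases h1.eq_or_lt with h | h
      · exact ⟨j + n, by omega, by omega, by rw [hB, h3]⟩
      · exact ⟨j, by omega, by omega, h3⟩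
  have hlow : ∀ m, n ≤ m → ¬ B m → m + 1 ≤ lastBefore B m + n := by
    intro m hm hBm
    obtain ⟨j, h1, h2, h3⟩ := hex m hm
    have h4 := le_lastBefore h3 h2
    have h5 : m ≠ lastBefore B m + n := by
      intro h
      rw [h, hB] at hBm
      exact hBm (lastBefore_spec h3 h2)
    omega
  have hTle : ∀ x y, x ≤ y + n → T x - T y ≤ Real.pi := by
    intro x y h
    have := hT.monotone h
    rw [hTn] at this
    linarith
  have hstrict : ∀ m, n ≤ m → ¬ B m → B' m →
      gapTerm T B m + Φ B (m + 1) + Φ B' m < gapTerm T B' m + Φ B m + Φ B' (m + 1) := by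
    intro m hm h h'
    have h1 := hlow m hm h
    have h2 := lastBefore_lt B (show 0 < m by omega)
    have h3 : T (m + 1 + 1) - T m < Real.pi := by
      have := hT (show m + 1 + 1 < m + n by omega)
      rw [hTn] at this
      linarith
    have := sin_four_point_lt (hT h2) (hT.monotone (Nat.le_succ m)) (hT (Nat.lt_succ_self (m + 1)))
      (by linarith [hTle _ _ h1])
    simp only [Φ, gapTerm, lastBefore_succ, h, h', if_true, Bool.false_eq_true, if_false]
    linarith
  have hstep : ∀ m, n ≤ m →
      gapTerm T B m + Φ B (m + 1) + Φ B' m ≤ gapTerm T B' m + Φ B m + Φ B' (m + 1) := by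
    intro m hm
    by_cases h : B m
    · simp only [Φ, gapTerm, lastBefore_succ, h, hle m h, if_true]
      linarith
    · by_cases h' : B' m
      · exact (hstrict m hm h h').le
      · have h1 := hlow m hm h
        have h2 := lastBefore_le B' m
        simp only [Φ, gapTerm, lastBefore_succ, h, h', Bool.false_eq_true, if_false]
        rcases (lastBefore_mono hle m).eq_or_lt with h3 | h3
        · rw [h3]
          linarith
        · have h4 : T (m + 1 + 1) - T (lastBefore B' m) ≤ Real.pi := hTle _ _ (by omega)
          have := sin_four_point_le (hT h3).le
            (hT.monotone (show lastBefore B' m ≤ m + 1 by omega))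
            (hT (Nat.lt_succ_self (m + 1))).le (by linarith [hTle _ _ h1])
          linarith
  have hper : ∀ A : ℕ → Bool, (∀ m, A (m + n) = A m) → A i → Φ A (n + n) = Φ A n := by
    intro A hA hAi
    simp only [Φ]
    rw [lastBefore_add hA hAi hin, show n + n + 1 = n + 1 + n by ring, hTn, hTn,
      add_sub_add_right_eq_sub]
  have htel : ∑ k ∈ Finset.range n, (Ψ (k + 1) - Ψ k) = 0 := by
    rw [Finset.sum_range_sub]
    simp only [Ψ, add_zero]
    rw [hper B hB hi, hper B' hB' (hle i hi)]
    ring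
  have hlt : ∑ k ∈ Finset.range n, (gapTerm T B (n + k) + (Ψ (k + 1) - Ψ k)) <
      ∑ k ∈ Finset.range n, gapTerm T B' (n + k) := by
    apply Finset.sum_lt_sum
    · intro k _
      have := hstep (n + k) (by omega)
      simp only [Ψ, ← add_assoc]
      linarith
    · refine ⟨d, Finset.mem_range.2 hdn, ?_⟩
      have := hstrict (n + d) (by omega) (by rw [add_comm, hB]; exact hdB)
        (by rw [add_comm, hB']; exact hdB')
      simp only [Ψ, ← add_assoc]
      linarith
  rwa [Finset.sum_add_distrib, htel, add_zero] at hlt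

/-- The angles of the antipodal point set, enumerated in increasing order and continued around the
circle indefinitely. -/
noncomputable def extAngle {n : ℕ} [NeZero n] (θ : Fin n → ℝ) (m : ℕ) : ℝ :=
  θ (Fin.ofNat n m) + (m / n : ℕ) * Real.pi

/-- Whether the point at angle `extAngle θ m` is a vertex of the polygon selected by `ε`. -/
def extColor {n : ℕ} [NeZero n] (ε : Fin n → Bool) (m : ℕ) : Bool :=
  ε (Fin.ofNat n m) != decide (m / n % 2 = 1)

section Extension

variable {n : ℕ} [NeZero n]

lemma extAngle_mul_add (θ : Fin n → ℝ) (q : ℕ) {r : ℕ} (hr : r < n) :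
    extAngle θ (n * q + r) = θ ⟨r, hr⟩ + q * Real.pi := by
  have h1 : Fin.ofNat n (n * q + r) = ⟨r, hr⟩ := by
    ext; simp [Fin.ofNat, Nat.mod_eq_of_lt hr]
  rw [extAngle, h1, Nat.mul_add_div (NeZero.pos n), Nat.div_eq_of_lt hr, add_zero]

lemma extColor_of_lt (ε : Fin n → Bool) {m : ℕ} (hm : m < n) : extColor ε m = ε ⟨m, hm⟩ := by
  have h1 : Fin.ofNat n m = ⟨m, hm⟩ := by
    ext; simp [Fin.ofNat, Nat.mod_eq_of_lt hm]
  rw [extColor, h1, Nat.div_eq_of_lt hm]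
  simp

lemma extAngle_add (θ : Fin n → ℝ) (m : ℕ) : extAngle θ (m + n) = extAngle θ m + Real.pi := by
  have h1 : Fin.ofNat n (m + n) = Fin.ofNat n m := by
    ext; simp [Fin.ofNat]
  rw [extAngle, extAngle, h1, Nat.add_div_right _ (NeZero.pos n)]
  push_cast
  ring

lemma extColor_add (ε : Fin n → Bool) (m : ℕ) : extColor ε (m + n) = !extColor ε m := by
  have h1 : Fin.ofNat n (m + n) = Fin.ofNat n m := by
    ext; simp [Fin.ofNat]
  rw [extColor, extColor, h1, Nat.add_div_right _ (NeZero.pos n)]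
  rcases Nat.mod_two_eq_zero_or_one (m / n) with h | h
  · have : (m / n).succ % 2 = 1 := by omega
    rw [h, this]; cases ε (Fin.ofNat n m) <;> rfl
  · have : (m / n).succ % 2 = 0 := by omega
    rw [h, this]; cases ε (Fin.ofNat n m) <;> rfl

lemma changes_extColor_mod (ε : Fin n → Bool) (m : ℕ) :
    changes (extColor ε) (m % n) = changes (extColor ε) m :=
  Function.Periodic.map_mod_nat (changes_add (extColor_add ε)) m

lemma extAngle_strictMono {θ : Fin n → ℝ} (hmono : StrictMono θ)
    (hrange : ∀ i, θ i ∈ Set.Ico 0 Real.pi) : StrictMono (extAngle θ) := by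
  apply strictMono_nat_of_lt_succ
  intro m
  have hr : m % n < n := Nat.mod_lt _ (NeZero.pos n)
  rw [← Nat.div_add_mod m n, extAngle_mul_add θ _ hr]
  rcases Nat.lt_or_ge (m % n + 1) n with h | h
  · rw [add_assoc, extAngle_mul_add θ _ h]
    exact add_lt_add_left (hmono (Fin.mk_lt_mk.2 (Nat.lt_succ_self _))) _
  · have h0 : 0 < n := NeZero.pos n
    rw [show n * (m / n) + m % n + 1 = n * (m / n + 1) + 0 by rw [mul_add]; omega,
      extAngle_mul_add θ _ h0]
    push_cast
    linarith [(hrange ⟨m % n, hr⟩).2, (hrange ⟨0, h0⟩).1]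

lemma pt_extAngle (θ : Fin n → ℝ) {ε : Fin n → Bool} {m : ℕ} (hm : extColor ε m) :
    pt (extAngle θ m) = vtx θ ε (Fin.ofNat n m) := by
  rw [pt, extAngle, Real.cos_add_nat_mul_pi, Real.sin_add_nat_mul_pi, vtx]
  rcases Nat.mod_two_eq_zero_or_one (m / n) with h | h
  · have hε : ε (Fin.ofNat n m) := by simpa [extColor, h] using hm
    rw [(Nat.even_iff.2 h).neg_one_pow, if_pos hε]
    simp [pt]
  · have hε : ε (Fin.ofNat n m) = false := by simpa [extColor, h] using hm
    rw [(Nat.odd_iff.2 h).neg_one_pow, if_neg (by rw [hε]; decide)]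
    simp [pt]

lemma range_vtx (θ : Fin n → ℝ) (ε : Fin n → Bool) (q : ℕ) :
    Set.range (vtx θ ε) =
      pt '' (extAngle θ '' {m | n * q ≤ m ∧ m < n * q + 2 * n ∧ extColor ε m}) := by
  apply Set.Subset.antisymm
  · rintro _ ⟨i, rfl⟩
    have hi := i.2
    have h1 : Fin.ofNat n (n * q + i) = i := by
      ext; simp [Fin.ofNat, Nat.mod_eq_of_lt hi]
    have h2 : Fin.ofNat n (n * q + i + n) = i := by
      ext; simp [Fin.ofNat, Nat.mod_eq_of_lt hi]
    by_cases hC : extColor ε (n * q + i)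
    · exact ⟨_, ⟨n * q + i, ⟨by omega, by omega, hC⟩, rfl⟩, by rw [pt_extAngle θ hC, h1]⟩
    · have hC' : extColor ε (n * q + i + n) := by rw [extColor_add]; simpa using hC
      exact ⟨_, ⟨n * q + i + n, ⟨by omega, by omega, hC'⟩, rfl⟩, by rw [pt_extAngle θ hC', h2]⟩
  · rintro _ ⟨_, ⟨m, ⟨-, -, hm⟩, rfl⟩, rfl⟩
    exact ⟨_, (pt_extAngle θ hm).symm⟩

lemma volume_real_apoly {θ : Fin n → ℝ} (hmono : StrictMono θ)
    (hrange : ∀ i, θ i ∈ Set.Ico 0 Real.pi) (ε : Fin n → Bool) :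
    volume.real (apoly θ ε) =
      (∑ k ∈ Finset.range n, gapTerm (extAngle θ) (changes (extColor ε)) (n + k)) / 2 := by
  obtain ⟨q, hq, hC⟩ : ∃ q, 1 ≤ q ∧ extColor ε (n * q) := by
    by_cases h : extColor ε (n * 1)
    · exact ⟨1, le_rfl, h⟩
    · refine ⟨2, by norm_num, ?_⟩
      rw [show n * 2 = n * 1 + n by ring, extColor_add]
      simpa using h
  rw [apoly, range_vtx θ ε q]
  exact volume_real_polygon (extAngle_strictMono hmono hrange) (NeZero.pos n) (extAngle_add θ)
    (extColor_add ε) (Nat.le_mul_of_pos_right n hq) hC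

lemma half_le_card_of_changes {C : ℕ → Bool} {l L : ℕ}
    (h : ∀ k, k + 1 < L → changes C (l + k)) :
    L / 2 ≤ ∑ k ∈ Finset.range L, if C (l + k) then 1 else 0 := by
  induction L using Nat.twoStepInduction with
  | zero => simp
  | one => simp
  | more L ih _ =>
    have h1 := ih fun k hk => h k (by omega)
    have h2 := h L (by omega)
    rw [Finset.sum_range_succ, Finset.sum_range_succ, add_assoc]
    have h3 : 1 ≤ (if C (l + L) then 1 else 0) + if C (l + (L + 1)) then 1 else 0 := by
      rw [changes, bne_iff_ne, add_assoc] at h2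
      by_cases hC : C (l + L)
      · simp [hC]
      · have : C (l + (L + 1)) := by
          cases h4 : C (l + (L + 1)) <;> simp_all
        simp [this]
    omega

lemma half_le_card_window {ε : Fin n → Bool} {c : ℕ}
    (h : ∀ m < n, m ≠ c → changes (extColor ε) m) (hc : Even n ∨ n ≤ c) (l : ℕ) :
    (n - 1) / 2 ≤ ∑ k ∈ Finset.range (n - 1), if extColor ε (l + k) then 1 else 0 := by
  have hn : 0 < n := NeZero.pos n
  have hch : ∀ m, m % n ≠ c → changes (extColor ε) m := fun m hm => by
    rw [← changes_extColor_mod]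
    exact h _ (Nat.mod_lt _ hn) hm
  by_cases hd : ∃ k < n - 1, (l + k) % n = c
  · obtain ⟨k, hk, rfl⟩ := hd
    have hev : Even n := hc.resolve_right (not_le.2 (Nat.mod_lt _ hn))
    have hother : ∀ j < n - 1, j ≠ k → changes (extColor ε) (l + j) := by
      intro j hj hjk
      apply hch
      intro h'
      have h1 : j ≡ k [MOD n] := Nat.ModEq.add_left_cancel' l h'
      have h2 := Nat.ModEq.eq_of_lt_of_lt h1 (by omega) (by omega)
      exact hjk h2
    obtain ⟨M, hM⟩ : ∃ M, n - 1 = k + 1 + M := ⟨n - 1 - (k + 1), by omega⟩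
    have h1 := half_le_card_of_changes (C := extColor ε) (l := l) (L := k + 1)
      fun j hj => hother j (by omega) (by omega)
    have h2 := half_le_card_of_changes (C := extColor ε) (l := l + (k + 1)) (L := M)
      fun j hj => by
        rw [add_assoc]
        exact hother _ (by omega) (by omega)
    rw [hM, Finset.sum_range_add]
    simp only [← add_assoc] at h1 h2 ⊢
    obtain ⟨p, hp⟩ := hev
    omega
  · push Not at hd
    exact half_le_card_of_changes fun k hk => hch _ (hd k (by omega))

lemma exists_polar {v : ℝ × ℝ} (hv : v ≠ 0) :
    ∃ r φ : ℝ, 0 < r ∧ -Real.pi < φ ∧ φ ≤ Real.pi ∧ v = (r * Real.cos φ, r * Real.sin φ) := by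
  let z : ℂ := ⟨v.1, v.2⟩
  have hz : z ≠ 0 := by
    intro h
    exact hv (Prod.ext (congrArg Complex.re h) (congrArg Complex.im h))
  exact ⟨‖z‖, z.arg, norm_pos_iff.2 hz, Complex.neg_pi_lt_arg z, Complex.arg_le_pi z,
    Prod.ext (Complex.norm_mul_cos_arg z).symm (Complex.norm_mul_sin_arg z).symm⟩

lemma exists_window {θ : Fin n → ℝ} (hmono : StrictMono θ)
    (hrange : ∀ i, θ i ∈ Set.Ico 0 Real.pi) {v : ℝ × ℝ} (hv : v ≠ 0) :
    ∃ l, ∀ k < n - 1, 0 < dotp v (pt (extAngle θ (l + k))) := by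
  obtain ⟨r, φ, hr, hφ1, hφ2, rfl⟩ := exists_polar hv
  have hn : 0 < n := NeZero.pos n
  have hpi := Real.pi_pos
  have hT := extAngle_strictMono hmono hrange
  have hex : ∃ m, φ + 2 * (2 * Real.pi) - Real.pi / 2 < extAngle θ m := by
    refine ⟨n * 5 + 0, ?_⟩
    rw [extAngle_mul_add θ 5 hn]
    push_cast
    linarith [(hrange ⟨0, hn⟩).1]
  classical
  have hl := Nat.find_spec hex
  have hl' := fun m => Nat.find_min hex (m := m)
  set l := Nat.find hex
  have h0 : l ≠ 0 := by
    intro h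
    have h0 := extAngle_mul_add θ 0 hn
    rw [mul_zero, zero_add, Nat.cast_zero, zero_mul, add_zero] at h0
    rw [h, h0] at hl
    linarith [(hrange ⟨0, hn⟩).2]
  have hprev := not_lt.1 (hl' (l - 1) (by omega))
  refine ⟨l, fun k hk => ?_⟩
  have h1 : extAngle θ l ≤ extAngle θ (l + k) := hT.monotone (by omega)
  have h2 : extAngle θ (l + k) < extAngle θ (l - 1 + n) := hT (by omega)
  rw [extAngle_add] at h2
  have hcos : 0 < Real.cos (extAngle θ (l + k) - (φ + 2 * (2 * Real.pi))) :=
    Real.cos_pos_of_mem_Ioo ⟨by linarith, by linarith⟩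
  have hper : Real.cos (extAngle θ (l + k) - (φ + 2 * (2 * Real.pi))) =
      Real.cos (extAngle θ (l + k) - φ) := by
    rw [← sub_sub]
    exact_mod_cast Real.cos_sub_nat_mul_two_pi (extAngle θ (l + k) - φ) 2
  rw [hper, Real.cos_sub] at hcos
  have : dotp (r * Real.cos φ, r * Real.sin φ) (pt (extAngle θ (l + k))) =
      r * (Real.cos (extAngle θ (l + k)) * Real.cos φ +
        Real.sin (extAngle θ (l + k)) * Real.sin φ) := by
    simp only [dotp, pt]; ring
  rw [this]
  positivity

lemma thick_of_changes {θ : Fin n → ℝ} (hmono : StrictMono θ)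
    (hrange : ∀ i, θ i ∈ Set.Ico 0 Real.pi) {ε : Fin n → Bool} {c : ℕ}
    (h : ∀ m < n, m ≠ c → changes (extColor ε) m) (hc : Even n ∨ n ≤ c) : Thick θ ε := by
  intro v hv
  obtain ⟨l, hl⟩ := exists_window hmono hrange hv
  refine (half_le_card_window h hc l).trans ?_
  rw [← Finset.card_filter]
  set F := (Finset.range (n - 1)).filter fun k => extColor ε (l + k)
  have hinj : Set.InjOn (fun k => Fin.ofNat n (l + k)) F := by
    intro j hj k hk hjk
    have hj' := Finset.mem_range.1 (Finset.mem_filter.1 hj).1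
    have hk' := Finset.mem_range.1 (Finset.mem_filter.1 hk).1
    have h1 : j ≡ k [MOD n] := Nat.ModEq.add_left_cancel' l (congrArg Fin.val hjk)
    exact Nat.ModEq.eq_of_lt_of_lt h1 (by omega) (by omega)
  rw [← Finset.card_image_of_injOn hinj, ← Set.ncard_coe_finset]
  apply Set.ncard_le_ncard _ (Set.toFinite _)
  intro i hi
  obtain ⟨k, hk, rfl⟩ := Finset.mem_image.1 (Finset.mem_coe.1 hi)
  obtain ⟨hk1, hk2⟩ := Finset.mem_filter.1 hk
  change 0 < dotp v (vtx θ ε (Fin.ofNat n (l + k)))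
  rw [← pt_extAngle θ hk2]
  exact hl k (Finset.mem_range.1 hk1)

/-- The alternating selection with a single repetition, after position `c`. -/
def altSelection (n c : ℕ) (i : Fin n) : Bool := decide ((i : ℕ) % 2 = 0) != decide (c < i)

lemma changes_altSelection {c : ℕ} (hc : n % 2 = 0 ∧ c < n ∨ n % 2 = 1 ∧ c = n) {m : ℕ}
    (hm : m < n) (hmc : m ≠ c) : changes (extColor (altSelection n c)) m := by
  have hn : 0 < n := NeZero.pos n
  rw [changes, extColor_of_lt _ hm]
  rcases Nat.lt_or_ge (m + 1) n with h | h
  · rw [extColor_of_lt _ h]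
    have h1 : ((m + 1) % 2 = 0) ↔ ¬ (m % 2 = 0) := by omega
    have h2 : c < m + 1 ↔ c < m := by omega
    simp only [altSelection, h1, h2]
    by_cases h3 : m % 2 = 0 <;> by_cases h4 : c < m <;> simp [h3, h4]
  · have hmn : m + 1 = 0 + n := by omega
    rw [hmn, extColor_add, extColor_of_lt _ hn]
    rcases hc with ⟨h1, h2⟩ | ⟨h1, rfl⟩
    · have h3 : ¬ (m % 2 = 0) := by omega
      have h4 : c < m := by omega
      simp [altSelection, h3, h4]
    · have h3 : m % 2 = 0 := by omega
      have h4 : ¬ (c < m) := by omega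
      simp [altSelection, h3, h4]

lemma exists_not_changes_of_not_thick {θ : Fin n → ℝ} (hmono : StrictMono θ)
    (hrange : ∀ i, θ i ∈ Set.Ico 0 Real.pi) {ε : Fin n → Bool} (h : ¬ Thick θ ε) {c : ℕ}
    (hc : Even n ∨ n ≤ c) : ∃ d < n, d ≠ c ∧ ¬ changes (extColor ε) d := by
  by_contra! hd
  exact h (thick_of_changes hmono hrange hd hc)

end Extension

/-- For every non-thick antipodal polygon there is a thick antipodal polygon
on the same point set with strictly larger area. -/
theorem stmt_9 (n : ℕ) (hn : 3 ≤ n) (θ : Fin n → ℝ) (hmono : StrictMono θ)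
    (hrange : ∀ i, θ i ∈ Set.Ico 0 Real.pi)
    (ε : Fin n → Bool) (h : ¬ Thick θ ε) :
    ∃ ε' : Fin n → Bool, Thick θ ε' ∧ volume (apoly θ ε) < volume (apoly θ ε') := by
  have : NeZero n := ⟨by omega⟩
  obtain ⟨c, hc, hcB⟩ : ∃ c, (n % 2 = 0 ∧ c < n ∨ n % 2 = 1 ∧ c = n) ∧
      (c < n → ¬ changes (extColor ε) c) := by
    rcases Nat.mod_two_eq_zero_or_one n with hn2 | hn2
    · obtain ⟨c, hcn, -, hcB⟩ := exists_not_changes_of_not_thick hmono hrange h (Or.inr le_rfl)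
      exact ⟨c, Or.inl ⟨hn2, hcn⟩, fun _ => hcB⟩
    · exact ⟨n, Or.inr ⟨hn2, rfl⟩, fun h => absurd h (lt_irrefl n)⟩
  have hc' : Even n ∨ n ≤ c := by
    rcases hc with ⟨h1, -⟩ | ⟨-, rfl⟩
    · exact Or.inl (Nat.even_iff.2 h1)
    · exact Or.inr le_rfl
  obtain ⟨d, hdn, hdc, hdB⟩ := exists_not_changes_of_not_thick hmono hrange h hc'
  have halt : ∀ m < n, m ≠ c → changes (extColor (altSelection n c)) m :=
    fun m hm hmc => changes_altSelection hc hm hmc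
  refine ⟨altSelection n c, thick_of_changes hmono hrange halt hc', ?_⟩
  have hfin : ∀ ε : Fin n → Bool, volume (apoly θ ε) ≠ ⊤ := fun ε =>
    ((Set.finite_range (vtx θ ε)).isCompact_convexHull (𝕜 := ℝ)).measure_ne_top
  rw [← ENNReal.toReal_lt_toReal (hfin _) (hfin _)]
  change volume.real _ < volume.real _
  rw [volume_real_apoly hmono hrange, volume_real_apoly hmono hrange]
  obtain ⟨i, hin, hi⟩ := exists_changes (extColor_add ε)
  have hle : ∀ m, changes (extColor ε) m → changes (extColor (altSelection n c)) m := by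
    intro m hm
    have hmn : m % n < n := Nat.mod_lt _ (by omega)
    rw [← changes_extColor_mod] at hm ⊢
    refine halt _ hmn ?_
    rintro rfl
    exact hcB hmn hm
  have := sum_gapTerm_lt (extAngle_strictMono hmono hrange) hn (extAngle_add θ)
    (changes_add (extColor_add ε)) (changes_add (extColor_add _)) hle hin hi hdn hdB
    (halt d hdn hdc)
  linarith
end

section
/- Let S be an antipodal point set of 2n points on the unit circle with n odd. Then there are exactly two thick antipodal polygons on S, they are point reflections of each other through the origin, and every thick antipodal polygon has strictly larger area than every non-thick antipodal polygon on S. -/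
open MeasureTheory

/-! ### Area of triangles -/

/-- The planar cross product. -/
def cross (v w : ℝ × ℝ) : ℝ := v.1 * w.2 - v.2 * w.1

theorem mem_convexHull_triple {a b c x : ℝ × ℝ} :
    x ∈ convexHull ℝ {a, b, c} ↔
      ∃ s t : ℝ, 0 ≤ s ∧ 0 ≤ t ∧ s + t ≤ 1 ∧ x = (1 - s - t) • a + s • b + t • c := by
  rw [convexHull_insert (by simp), convexHull_pair]
  simp only [convexJoin_singleton_left, Set.mem_iUnion, exists_prop]
  constructor
  · rintro ⟨y, ⟨p, q, hp, hq, hpq, rfl⟩, ⟨u, v, hu, hv, huv, rfl⟩⟩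
    refine ⟨v * p, v * q, by positivity, by positivity, by nlinarith, ?_⟩
    have hp' : p = 1 - q := by linarith
    have hu' : u = 1 - v := by linarith
    subst hp' hu'
    ext <;> simp <;> ring
  · rintro ⟨s, t, hs, ht, hst, rfl⟩
    rcases (add_nonneg hs ht).eq_or_lt' with h | h
    · have hs0 : s = 0 := by linarith
      have ht0 : t = 0 := by linarith
      subst hs0 ht0
      refine ⟨b, left_mem_segment ℝ b c, ?_⟩
      simpa using left_mem_segment ℝ a b
    · refine ⟨(s / (s + t)) • b + (t / (s + t)) • c,
        ⟨s / (s + t), t / (s + t), by positivity, by positivity, by field_simp, rfl⟩,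
        ⟨1 - s - t, s + t, by linarith, h.le, by ring, ?_⟩⟩
      rw [smul_add, smul_smul, smul_smul, mul_div_cancel₀ _ h.ne', mul_div_cancel₀ _ h.ne',
        add_assoc]

theorem volume_standard_triangle :
    volume {p : ℝ × ℝ | 0 ≤ p.1 ∧ 0 ≤ p.2 ∧ p.1 + p.2 ≤ 1} = ENNReal.ofReal (1 / 2) := by
  have hm : MeasurableSet {p : ℝ × ℝ | 0 ≤ p.1 ∧ 0 ≤ p.2 ∧ p.1 + p.2 ≤ 1} := by
    apply IsClosed.measurableSet
    exact (isClosed_le continuous_const continuous_fst).inter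
      ((isClosed_le continuous_const continuous_snd).inter
        (isClosed_le (continuous_fst.add continuous_snd) continuous_const))
  rw [Measure.volume_eq_prod, Measure.prod_apply hm]
  have h : ∀ x : ℝ, volume (Prod.mk x ⁻¹' {p : ℝ × ℝ | 0 ≤ p.1 ∧ 0 ≤ p.2 ∧ p.1 + p.2 ≤ 1}) =
      (Set.Icc (0 : ℝ) 1).indicator (fun x => ENNReal.ofReal (1 - x)) x := by
    intro x
    by_cases hx : x ∈ Set.Icc (0 : ℝ) 1
    · rw [Set.indicator_of_mem hx]
      have : Prod.mk x ⁻¹' {p : ℝ × ℝ | 0 ≤ p.1 ∧ 0 ≤ p.2 ∧ p.1 + p.2 ≤ 1} =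
          Set.Icc 0 (1 - x) := by
        ext y
        simp only [Set.mem_preimage, Set.mem_ofPred_eq, Set.mem_Icc]
        exact ⟨fun h => ⟨h.2.1, by linarith⟩, fun h => ⟨hx.1, h.1, by linarith⟩⟩
      rw [this, Real.volume_Icc, sub_zero]
    · rw [Set.indicator_of_notMem hx]
      have : Prod.mk x ⁻¹' {p : ℝ × ℝ | 0 ≤ p.1 ∧ 0 ≤ p.2 ∧ p.1 + p.2 ≤ 1} = ∅ := by
        ext y
        simp only [Set.mem_preimage, Set.mem_ofPred_eq, Set.mem_empty_iff_false, iff_false]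
        exact fun h => hx ⟨h.1, by linarith⟩
      rw [this, measure_empty]
  simp_rw [h]
  rw [lintegral_indicator measurableSet_Icc, ← ofReal_integral_eq_lintegral_ofReal]
  · rw [integral_Icc_eq_integral_Ioc, ← intervalIntegral.integral_of_le zero_le_one]
    congr 1
    rw [intervalIntegral.integral_sub (by simp) (by simp), integral_id]
    norm_num
  · exact (by fun_prop : Continuous fun x : ℝ => 1 - x).integrableOn_Icc
  · exact (ae_restrict_mem measurableSet_Icc).mono fun x hx => sub_nonneg.2 hx.2

theorem volume_convexHull_triple (a b c : ℝ × ℝ) :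
    volume (convexHull ℝ {a, b, c}) = ENNReal.ofReal (|cross (b - a) (c - a)| / 2) := by
  let M : Matrix (Fin 2) (Fin 2) ℝ := !![(b - a).1, (c - a).1; (b - a).2, (c - a).2]
  let L : (ℝ × ℝ) →ₗ[ℝ] ℝ × ℝ :=
    Matrix.toLin (Module.Basis.finTwoProd ℝ) (Module.Basis.finTwoProd ℝ) M
  have hL : ∀ p, L p = p.1 • (b - a) + p.2 • (c - a) := by
    intro p
    simp only [L, M, Matrix.toLin_finTwoProd_apply]
    ext <;> simp <;> ring
  have hdet : LinearMap.det L = cross (b - a) (c - a) := by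
    simp only [L, LinearMap.det_toLin, M, Matrix.det_fin_two_of, cross]
    ring
  have himg : convexHull ℝ {a, b, c} =
      (fun x => a + x) '' (L '' {p : ℝ × ℝ | 0 ≤ p.1 ∧ 0 ≤ p.2 ∧ p.1 + p.2 ≤ 1}) := by
    ext x
    rw [mem_convexHull_triple, Set.image_image]
    simp only [Set.mem_image, Set.mem_ofPred_eq, Prod.exists, hL]
    constructor
    · rintro ⟨s, t, hs, ht, hst, rfl⟩
      exact ⟨s, t, ⟨hs, ht, hst⟩, by module⟩
    · rintro ⟨s, t, ⟨hs, ht, hst⟩, rfl⟩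
      exact ⟨s, t, hs, ht, hst, by module⟩
  rw [himg, Set.image_add_left, measure_preimage_add, Measure.addHaar_image_linearMap,
    volume_standard_triangle, hdet, ← ENNReal.ofReal_mul (abs_nonneg _)]
  congr 1
  ring

/-! ### Area of convex polygons inscribed in the unit circle -/

/-- An affine function vanishing on the chord through `pt α` and `pt β`. -/
noncomputable def chordFun (α β : ℝ) (x : ℝ × ℝ) : ℝ :=
  Real.cos ((α + β) / 2) * x.1 + Real.sin ((α + β) / 2) * x.2 - Real.cos ((β - α) / 2)

theorem chordFun_pt (α β φ : ℝ) :
    chordFun α β (pt φ) = Real.cos (φ - (α + β) / 2) - Real.cos ((β - α) / 2) := by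
  rw [chordFun, pt, Real.cos_sub φ]
  ring

theorem chordFun_combo (α β : ℝ) (x y : ℝ × ℝ) {s t : ℝ} (h : s + t = 1) :
    chordFun α β (s • x + t • y) = s * chordFun α β x + t * chordFun α β y := by
  have hs : s = 1 - t := by linarith
  subst hs
  simp only [chordFun, Prod.fst_add, Prod.snd_add, Prod.smul_fst, Prod.smul_snd, smul_eq_mul]
  ring

theorem convex_chordFun_nonneg (α β : ℝ) : Convex ℝ {x | 0 ≤ chordFun α β x} := by
  intro x hx y hy s t hs ht hst
  simp only [Set.mem_ofPred_eq] at *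
  rw [chordFun_combo α β x y hst]
  positivity

theorem convex_chordFun_nonpos (α β : ℝ) : Convex ℝ {x | chordFun α β x ≤ 0} := by
  intro x hx y hy s t hs ht hst
  simp only [Set.mem_ofPred_eq] at *
  rw [chordFun_combo α β x y hst]
  nlinarith [mul_nonneg hs (neg_nonneg.2 hx), mul_nonneg ht (neg_nonneg.2 hy)]

theorem chordFun_pt_nonneg {α β φ : ℝ} (h₁ : α ≤ φ) (h₂ : φ ≤ β) (h : β ≤ α + 2 * Real.pi) :
    0 ≤ chordFun α β (pt φ) := by
  rw [chordFun_pt, sub_nonneg, ← Real.cos_abs (φ - _)]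
  exact Real.cos_le_cos_of_nonneg_of_le_pi (abs_nonneg _) (by linarith)
    (abs_le.2 ⟨by linarith, by linarith⟩)

theorem chordFun_pt_nonpos {α β φ : ℝ} (hαβ : α ≤ β) (h₁ : β ≤ φ) (h₂ : φ ≤ α + 2 * Real.pi) :
    chordFun α β (pt φ) ≤ 0 := by
  rw [chordFun_pt, sub_nonpos]
  rcases le_total (φ - (α + β) / 2) Real.pi with h | h
  · exact Real.cos_le_cos_of_nonneg_of_le_pi (by linarith) h (by linarith)
  · rw [← Real.cos_two_pi_sub]
    exact Real.cos_le_cos_of_nonneg_of_le_pi (by linarith) (by linarith) (by linarith)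

theorem convex_unit_disc : Convex ℝ {x : ℝ × ℝ | x.1 ^ 2 + x.2 ^ 2 ≤ 1} := by
  intro x hx y hy s t hs ht hst
  simp only [Set.mem_ofPred_eq, Prod.fst_add, Prod.snd_add, Prod.smul_fst, Prod.smul_snd,
    smul_eq_mul] at *
  have ht' : s = 1 - t := by linarith
  subst ht'
  nlinarith [mul_nonneg hs ht, mul_nonneg (mul_nonneg hs ht) (sq_nonneg (x.1 - y.1)),
    mul_nonneg (mul_nonneg hs ht) (sq_nonneg (x.2 - y.2)), mul_le_mul_of_nonneg_left hx hs,
    mul_le_mul_of_nonneg_left hy ht]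

theorem pt_mem_unit_disc (φ : ℝ) : pt φ ∈ {x : ℝ × ℝ | x.1 ^ 2 + x.2 ^ 2 ≤ 1} := by
  simp [pt]

theorem mem_segment_of_chordFun_eq_zero {α β : ℝ} (hαβ : α < β) (h : β < α + 2 * Real.pi)
    {x : ℝ × ℝ} (hx : x.1 ^ 2 + x.2 ^ 2 ≤ 1) (hx0 : chordFun α β x = 0) :
    x ∈ segment ℝ (pt α) (pt β) := by
  obtain ⟨m, hm⟩ : ∃ m, m = (α + β) / 2 := ⟨_, rfl⟩
  obtain ⟨d, hd⟩ : ∃ d, d = (β - α) / 2 := ⟨_, rfl⟩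
  have hα : α = m - d := by rw [hm, hd]; ring
  have hβ : β = m + d := by rw [hm, hd]; ring
  rw [chordFun, ← hm, ← hd] at hx0
  have hsin : 0 < Real.sin d := Real.sin_pos_of_pos_of_lt_pi (by linarith) (by linarith)
  have hm1 := Real.sin_sq_add_cos_sq m
  have hd1 := Real.sin_sq_add_cos_sq d
  obtain ⟨s, hs⟩ : ∃ s, s = -Real.sin m * x.1 + Real.cos m * x.2 := ⟨_, rfl⟩
  have hx1 : x.1 = Real.cos d * Real.cos m - s * Real.sin m := by
    rw [hs, ← sub_eq_zero.1 hx0]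
    linear_combination (-x.1) * hm1
  have hx2 : x.2 = Real.cos d * Real.sin m + s * Real.cos m := by
    rw [hs, ← sub_eq_zero.1 hx0]
    linear_combination (-x.2) * hm1
  have hs2 : s ^ 2 ≤ Real.sin d ^ 2 := by
    have : x.1 ^ 2 + x.2 ^ 2 = Real.cos d ^ 2 + s ^ 2 := by
      rw [hx1, hx2]
      linear_combination (Real.cos d ^ 2 + s ^ 2) * hm1
    linarith
  obtain ⟨h1, h2⟩ := abs_le.1 (abs_le_of_sq_le_sq hs2 hsin.le)
  refine ⟨(Real.sin d - s) / (2 * Real.sin d), (Real.sin d + s) / (2 * Real.sin d),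
    div_nonneg (by linarith) (by linarith), div_nonneg (by linarith) (by linarith),
    by field_simp; ring, ?_⟩
  rw [hα, hβ, pt, pt, Real.cos_sub, Real.sin_sub, Real.cos_add, Real.sin_add]
  ext
  · simp only [Prod.fst_add, Prod.smul_fst, smul_eq_mul, hx1]
    field_simp
    ring
  · simp only [Prod.snd_add, Prod.smul_snd, smul_eq_mul, hx2]
    field_simp
    ring

theorem cross_pt (a b c : ℝ) :
    cross (pt b - pt a) (pt c - pt a) =
      Real.sin (b - a) + Real.sin (c - b) + Real.sin (a - c) := by
  simp only [cross, pt, Prod.fst_sub, Prod.snd_sub, Real.sin_sub]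
  ring

theorem sin_triangle (a b c : ℝ) :
    Real.sin (b - a) + Real.sin (c - b) + Real.sin (a - c) =
      4 * Real.sin ((b - a) / 2) * Real.sin ((c - b) / 2) * Real.sin ((c - a) / 2) := by
  obtain ⟨x, hx⟩ : ∃ x, x = (b - a) / 2 := ⟨_, rfl⟩
  obtain ⟨y, hy⟩ : ∃ y, y = (c - b) / 2 := ⟨_, rfl⟩
  have h1 : b - a = 2 * x := by rw [hx]; ring
  have h2 : c - b = 2 * y := by rw [hy]; ring
  have h3 : a - c = -(2 * (x + y)) := by rw [hx, hy]; ring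
  have h4 : (c - a) / 2 = x + y := by rw [hx, hy]; ring
  rw [h4, ← hx, ← hy, h1, h2, h3, Real.sin_neg, Real.sin_two_mul, Real.sin_two_mul,
    Real.sin_two_mul, Real.sin_add, Real.cos_add]
  linear_combination (-2 * Real.sin x * Real.cos x) * Real.sin_sq_add_cos_sq y
    + (-2 * Real.sin y * Real.cos y) * Real.sin_sq_add_cos_sq x

theorem sin_triangle_nonneg {a b c : ℝ} (h₁ : a ≤ b) (h₂ : b ≤ c) (h : c ≤ a + 2 * Real.pi) :
    0 ≤ Real.sin (b - a) + Real.sin (c - b) + Real.sin (a - c) := by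
  rw [sin_triangle]
  have h1 := Real.sin_nonneg_of_nonneg_of_le_pi (x := (b - a) / 2) (by linarith) (by linarith)
  have h2 := Real.sin_nonneg_of_nonneg_of_le_pi (x := (c - b) / 2) (by linarith) (by linarith)
  have h3 := Real.sin_nonneg_of_nonneg_of_le_pi (x := (c - a) / 2) (by linarith) (by linarith)
  positivity

theorem volume_triangle_pt {a b c : ℝ} (h₁ : a ≤ b) (h₂ : b ≤ c) (h : c ≤ a + 2 * Real.pi) :
    volume (convexHull ℝ {pt a, pt b, pt c}) =
      ENNReal.ofReal ((Real.sin (b - a) + Real.sin (c - b) + Real.sin (a - c)) / 2) := by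
  rw [volume_convexHull_triple, cross_pt, abs_of_nonneg (sin_triangle_nonneg h₁ h₂ h)]

/-- Adding a point of the unit circle beyond the chord `pt α`, `pt β` to a convex hull of points of
the circle on the other side of this chord amounts to gluing a triangle along the chord. -/
theorem volume_convexHull_insert_pt {α β γ : ℝ} (hαβ : α < β) (hβγ : β ≤ γ)
    (hγ : γ ≤ α + 2 * Real.pi) (hβ : β < α + 2 * Real.pi) {Φ : Set ℝ}
    (hα : α ∈ Φ) (hβΦ : β ∈ Φ) (hΦ : Φ ⊆ Set.Icc α β) :
    volume (convexHull ℝ (insert (pt γ) (pt '' Φ))) =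
      volume (convexHull ℝ (pt '' Φ)) + volume (convexHull ℝ {pt α, pt β, pt γ}) := by
  set C := convexHull ℝ (pt '' Φ)
  set T := convexHull ℝ {pt α, pt β, pt γ}
  have hαC : pt α ∈ C := subset_convexHull ℝ _ ⟨α, hα, rfl⟩
  have hβC : pt β ∈ C := subset_convexHull ℝ _ ⟨β, hβΦ, rfl⟩
  have hsegC : segment ℝ (pt α) (pt β) ⊆ C :=
    (convex_convexHull ℝ _).segment_subset hαC hβC
  have hsegT : segment ℝ (pt α) (pt β) ⊆ T :=
    (convex_convexHull ℝ _).segment_subset (subset_convexHull ℝ _ (by simp))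
      (subset_convexHull ℝ _ (by simp))
  have hγT : pt γ ∈ T := subset_convexHull ℝ _ (by simp)
  have hCdisc : C ⊆ {x : ℝ × ℝ | x.1 ^ 2 + x.2 ^ 2 ≤ 1} := by
    refine convexHull_min ?_ convex_unit_disc
    rintro _ ⟨φ, -, rfl⟩
    exact pt_mem_unit_disc φ
  have hCpos : C ⊆ {x | 0 ≤ chordFun α β x} := by
    refine convexHull_min ?_ (convex_chordFun_nonneg α β)
    rintro _ ⟨φ, hφ, rfl⟩
    exact chordFun_pt_nonneg (hΦ hφ).1 (hΦ hφ).2 hβ.le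
  have hTneg : T ⊆ {x | chordFun α β x ≤ 0} := by
    refine convexHull_min ?_ (convex_chordFun_nonpos α β)
    rintro _ (rfl | rfl | rfl)
    · rw [Set.mem_ofPred_eq, chordFun_pt, show α - (α + β) / 2 = -((β - α) / 2) by ring,
        Real.cos_neg, sub_self]
    · exact chordFun_pt_nonpos hαβ.le le_rfl hβ.le
    · exact chordFun_pt_nonpos hαβ.le hβγ hγ
  have hunion : convexHull ℝ (insert (pt γ) (pt '' Φ)) = C ∪ T := by
    apply Set.Subset.antisymm
    · rw [convexHull_insert (Set.Nonempty.image _ ⟨α, hα⟩)]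
      intro x hx
      simp only [convexJoin_singleton_left, Set.mem_iUnion, exists_prop] at hx
      obtain ⟨y, hy, hxy⟩ := hx
      have hy0 : 0 ≤ chordFun α β y := hCpos hy
      have hγ0 : chordFun α β (pt γ) ≤ 0 := hTneg hγT
      rcases hy0.eq_or_lt' with hy0 | hy0
      · right
        exact (convex_convexHull ℝ _).segment_subset hγT
          (hsegT (mem_segment_of_chordFun_eq_zero hαβ hβ (hCdisc hy) hy0)) hxy
      obtain ⟨s, t, hs, ht, hst, rfl⟩ := hxy
      set p := chordFun α β (pt γ)
      set q := chordFun α β y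
      have hqp : 0 < q - p := by linarith
      obtain ⟨z, hz⟩ : ∃ z, z = (q / (q - p)) • pt γ + (-p / (q - p)) • y := ⟨_, rfl⟩
      have hsum : q / (q - p) + -p / (q - p) = 1 := by
        rw [← add_div, ← sub_eq_add_neg, div_self hqp.ne']
      have hq' : 0 ≤ q / (q - p) := by positivity
      have hp' : 0 ≤ -p / (q - p) := div_nonneg (by linarith) hqp.le
      have hz0 : chordFun α β z = 0 := by
        rw [hz, chordFun_combo α β _ _ hsum]
        change q / (q - p) * p + -p / (q - p) * q = 0
        ring
      have hzd : z ∈ {x : ℝ × ℝ | x.1 ^ 2 + x.2 ^ 2 ≤ 1} := by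
        rw [hz]
        exact convex_unit_disc (pt_mem_unit_disc γ) (hCdisc hy) hq' hp' hsum
      have hzseg := mem_segment_of_chordFun_eq_zero hαβ hβ hzd hz0
      have ht' : t = 1 - s := by linarith
      rcases le_total (s * (q - p)) q with h | h
      · left
        have hsq : 0 ≤ s * (q - p) / q := by positivity
        have hsq1 : s * (q - p) / q ≤ 1 := (div_le_one hy0).2 h
        convert convex_convexHull ℝ (pt '' Φ) (hsegC hzseg) hy hsq (sub_nonneg.2 hsq1)
          (by ring) using 1
        rw [hz, ht']
        match_scalars <;> field_simp
        ring
      · right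
        rcases hγ0.eq_or_lt with hp0 | hp0
        · have hs1 : s = 1 := by nlinarith
          have ht0 : t = 0 := by linarith
          rwa [hs1, ht0, one_smul, zero_smul, add_zero]
        have htp : 0 ≤ t * (q - p) / -p := div_nonneg (by positivity) (by linarith)
        have htp1 : t * (q - p) / -p ≤ 1 := (div_le_one (by linarith)).2 (by rw [ht']; nlinarith)
        convert convex_convexHull ℝ {pt α, pt β, pt γ} (hsegT hzseg) hγT htp (sub_nonneg.2 htp1)
          (by ring) using 1
        have hpn := hp0.ne
        rw [hz, ht']
        match_scalars <;> field_simp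
        ring
    · apply Set.union_subset
      · exact convexHull_mono (Set.subset_insert _ _)
      · apply convexHull_mono
        rintro _ (rfl | rfl | rfl)
        · exact Or.inr ⟨_, hα, rfl⟩
        · exact Or.inr ⟨_, hβΦ, rfl⟩
        · exact Or.inl rfl
  have hdisj : AEDisjoint volume C T := by
    refine measure_mono_null (t := convexHull ℝ {pt α, pt β, pt β}) ?_ ?_
    · intro x hx
      have : x ∈ segment ℝ (pt α) (pt β) :=
        mem_segment_of_chordFun_eq_zero hαβ hβ (hCdisc hx.1) (le_antisymm (hTneg hx.2) (hCpos hx.1))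
      simpa [convexHull_pair] using this
    · rw [volume_triangle_pt hαβ.le le_rfl hβ.le, ← neg_sub β α, Real.sin_neg]
      simp
  have hTm : NullMeasurableSet T volume :=
    (Set.Finite.isCompact_convexHull ℝ (by simp)).isClosed.measurableSet.nullMeasurableSet
  rw [hunion, measure_union₀ hTm hdisj]

/-- The shoelace formula for the convex hull of points on the unit circle, listed in
counterclockwise order, possibly with repetitions. -/
theorem volume_convexHull_pt_image {φ : ℕ → ℝ} (hφ : Monotone φ) (N : ℕ)
    (hN : φ N ≤ φ 0 + 2 * Real.pi) :
    0 ≤ ((∑ i ∈ Finset.range N, Real.sin (φ (i + 1) - φ i)) + Real.sin (φ 0 - φ N)) / 2 ∧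
    volume (convexHull ℝ (pt '' (φ '' Set.Iic N))) = ENNReal.ofReal
      (((∑ i ∈ Finset.range N, Real.sin (φ (i + 1) - φ i)) + Real.sin (φ 0 - φ N)) / 2) := by
  induction N with
  | zero =>
    have h : Set.Iic (0 : ℕ) = {0} := by ext; simp
    simp [h]
  | succ k ih =>
    have hk : φ k ≤ φ (k + 1) := hφ k.le_succ
    obtain ⟨ih0, ih⟩ := ih (hk.trans hN)
    have h0k : φ 0 ≤ φ k := hφ (Nat.zero_le k)
    have hset : pt '' (φ '' Set.Iic (k + 1)) = insert (pt (φ (k + 1))) (pt '' (φ '' Set.Iic k)) := by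
      rw [← Set.image_insert_eq, ← Set.image_insert_eq]
      congr 2
      ext i
      simp only [Set.mem_Iic, Set.mem_insert_iff]
      omega
    have htri := sin_triangle_nonneg h0k hk hN
    have hneg : Real.sin (φ k - φ 0) = -Real.sin (φ 0 - φ k) := by
      rw [← Real.sin_neg, neg_sub]
    have hsum : ((∑ i ∈ Finset.range (k + 1), Real.sin (φ (i + 1) - φ i)) +
        Real.sin (φ 0 - φ (k + 1))) / 2 =
        ((∑ i ∈ Finset.range k, Real.sin (φ (i + 1) - φ i)) + Real.sin (φ 0 - φ k)) / 2 +
        (Real.sin (φ k - φ 0) + Real.sin (φ (k + 1) - φ k) + Real.sin (φ 0 - φ (k + 1))) / 2 := by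
      rw [Finset.sum_range_succ, hneg]
      ring
    refine ⟨by rw [hsum]; linarith, ?_⟩
    rw [hsum, ENNReal.ofReal_add ih0 (by linarith), ← ih, ← volume_triangle_pt h0k hk hN, hset]
    rcases h0k.eq_or_lt with h | h
    · have hc : pt '' (φ '' Set.Iic k) = {pt (φ 0)} := by
        apply Set.Subset.antisymm
        · rintro _ ⟨_, ⟨i, hi, rfl⟩, rfl⟩
          rw [le_antisymm ((hφ hi).trans h.ge) (hφ (Nat.zero_le i))]
          rfl
        · rintro _ rfl
          exact ⟨_, ⟨0, Nat.zero_le k, rfl⟩, rfl⟩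
      rw [hc, ← h, Set.pair_comm, convexHull_singleton]
      simp
    · rcases (hk.trans hN).eq_or_lt with h' | h'
      · have hpt : pt (φ k) = pt (φ 0) := by simp [h', pt]
        have he : φ (k + 1) = φ k := le_antisymm (hN.trans h'.ge) hk
        have hmem : pt (φ (k + 1)) ∈ pt '' (φ '' Set.Iic k) :=
          ⟨_, ⟨k, Set.self_mem_Iic, rfl⟩, by rw [he]⟩
        rw [Set.insert_eq_of_mem hmem, he, hpt]
        simp
      · refine volume_convexHull_insert_pt h hk hN h'
          ⟨0, Nat.zero_le k, rfl⟩ ⟨k, Set.self_mem_Iic, rfl⟩ ?_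
        rintro _ ⟨i, hi, rfl⟩
        exact ⟨hφ (Nat.zero_le i), hφ hi⟩

/-! ### The doubled circular sequence of an antipodal point set -/

section Circular

variable {n : ℕ}

/-- The angle of the `j`-th point of the antipodal point set, with `circAngle θ (j + n)` being
`circAngle θ j + π`. -/
noncomputable def circAngle [NeZero n] (θ : Fin n → ℝ) (j : ℕ) : ℝ :=
  θ (Fin.ofNat n j) + (j / n : ℕ) * Real.pi

/-- Whether the `j`-th point in circular order is a vertex of the antipodal polygon. -/
def circSel [NeZero n] (ε : Fin n → Bool) (j : ℕ) : Bool :=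
  ε (Fin.ofNat n j) ^^ decide (j / n % 2 = 1)

theorem ofNat_add_self [NeZero n] (j : ℕ) : Fin.ofNat n (j + n) = Fin.ofNat n j := by
  ext
  simp

theorem circAngle_add [NeZero n] (θ : Fin n → ℝ) (j : ℕ) :
    circAngle θ (j + n) = circAngle θ j + Real.pi := by
  rw [circAngle, circAngle, ofNat_add_self, Nat.add_div_right _ (NeZero.pos n)]
  push_cast
  ring

theorem circSel_add [NeZero n] (ε : Fin n → Bool) (j : ℕ) :
    circSel ε (j + n) = !circSel ε j := by
  rw [circSel, circSel, ofNat_add_self, Nat.add_div_right _ (NeZero.pos n), ← Bool.xor_not]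
  congr 1
  rcases Nat.mod_two_eq_zero_or_one (j / n) with h | h <;> simp [Nat.add_mod, h]

theorem circSel_val [NeZero n] (ε : Fin n → Bool) (i : Fin n) : circSel ε i = ε i := by
  simp [circSel, Nat.div_eq_of_lt i.isLt]

theorem strictMono_circAngle [NeZero n] {θ : Fin n → ℝ} (hmono : StrictMono θ)
    (hrange : ∀ i, θ i ∈ Set.Ico 0 Real.pi) : StrictMono (circAngle θ) := by
  refine strictMono_nat_of_lt_succ fun j => ?_
  have hn := NeZero.pos n
  rw [circAngle, circAngle]
  by_cases h : (j + 1) % n = 0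
  · have h1 : (j + 1) / n = j / n + 1 := by
      rw [Nat.succ_div_of_dvd (Nat.dvd_of_mod_eq_zero h)]
    rw [h1]
    have := (hrange (Fin.ofNat n j)).2
    have := (hrange (Fin.ofNat n (j + 1))).1
    push_cast
    linarith
  · have h1 : (j + 1) / n = j / n :=
      Nat.succ_div_of_not_dvd fun hd => h (Nat.mod_eq_zero_of_dvd hd)
    rw [h1]
    have : Fin.ofNat n j < Fin.ofNat n (j + 1) := by
      rw [Fin.lt_def, Fin.val_ofNat, Fin.val_ofNat]
      have e1 := Nat.div_add_mod j n
      have e2 := Nat.div_add_mod (j + 1) n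
      rw [h1] at e2
      omega
    have := hmono this
    linarith

theorem pt_circAngle [NeZero n] (θ : Fin n → ℝ) (ε : Fin n → Bool) (j : ℕ) :
    pt (circAngle θ j) =
      if circSel ε j then vtx θ ε (Fin.ofNat n j) else -vtx θ ε (Fin.ofNat n j) := by
  have h : pt (circAngle θ j) =
      if j / n % 2 = 1 then -pt (θ (Fin.ofNat n j)) else pt (θ (Fin.ofNat n j)) := by
    rw [circAngle, pt, Real.cos_add_nat_mul_pi, Real.sin_add_nat_mul_pi]
    rcases Nat.mod_two_eq_zero_or_one (j / n) with h | h
    · simp [h, (Nat.even_iff.2 h).neg_one_pow, pt]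
    · simp [h, (Nat.odd_iff.2 h).neg_one_pow, pt]
  rw [h, circSel, vtx]
  by_cases h1 : j / n % 2 = 1 <;> cases ε (Fin.ofNat n j) <;> simp [h1]

theorem exists_mem_Ico_ofNat_eq [NeZero n] (j : ℕ) (i : Fin n) :
    ∃ m ∈ Finset.Ico j (j + n), Fin.ofNat n m = i := by
  have hi : (i : ℕ) ∈ (Finset.Ico j (j + n)).image (· % n) := by
    rw [Nat.image_Ico_mod]
    exact Finset.mem_range.2 i.isLt
  obtain ⟨m, hm, h⟩ := Finset.mem_image.1 hi
  exact ⟨m, hm, Fin.ext h⟩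

theorem range_vtx_eq [NeZero n] (θ : Fin n → ℝ) (ε : Fin n → Bool) :
    Set.range (vtx θ ε) = {x | ∃ j < 2 * n, circSel ε j ∧ pt (circAngle θ j) = x} := by
  ext x
  constructor
  · rintro ⟨i, rfl⟩
    have hp : ∀ j, Fin.ofNat n j = i → circSel ε j → pt (circAngle θ j) = vtx θ ε i := by
      intro j hj hs
      rw [pt_circAngle θ ε, if_pos hs, hj]
    have hi : Fin.ofNat n (i : ℕ) = i := by ext; simp
    have hlt := i.isLt
    cases h : circSel ε i
    · have h' : circSel ε (i + n) = true := by rw [circSel_add, h]; rfl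
      exact ⟨i + n, by omega, h', hp _ (by rw [ofNat_add_self, hi]) h'⟩
    · exact ⟨i, by omega, h, hp _ hi h⟩
  · rintro ⟨j, -, hs, rfl⟩
    exact ⟨Fin.ofNat n j, by rw [pt_circAngle θ ε, if_pos hs]⟩

theorem dotp_pt_pt (a b : ℝ) : dotp (pt a) (pt b) = Real.cos (b - a) := by
  rw [dotp, pt, pt, Real.cos_sub]
  ring

theorem dotp_neg_right (v w : ℝ × ℝ) : dotp v (-w) = -dotp v w := by
  simp only [dotp, Prod.fst_neg, Prod.snd_neg]
  ring

theorem dotp_neg_left (v w : ℝ × ℝ) : dotp (-v) w = -dotp v w := by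
  simp only [dotp, Prod.fst_neg, Prod.snd_neg]
  ring

theorem pt_ne_zero (a : ℝ) : pt a ≠ 0 := by
  intro h
  have := Real.sin_sq_add_cos_sq a
  rw [pt, Prod.mk_eq_zero] at h
  rw [h.1, h.2] at this
  norm_num at this

/-! ### Thick polygons are the alternating ones -/

theorem dotp_vtx_pos_iff [NeZero n] (θ : Fin n → ℝ) (ε : Fin n → Bool) (v : ℝ × ℝ) (j : ℕ) :
    0 < dotp v (vtx θ ε (Fin.ofNat n j)) ↔
      if circSel ε j then 0 < dotp v (pt (circAngle θ j)) else dotp v (pt (circAngle θ j)) < 0 := by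
  rw [pt_circAngle θ ε j]
  split_ifs
  · rfl
  · rw [dotp_neg_right, neg_lt_zero]

theorem dotp_normal (θ : ℝ) (φ : ℝ) : dotp (pt (θ + Real.pi / 2)) (pt φ) = Real.sin (φ - θ) := by
  rw [dotp_pt_pt, ← sub_sub, Real.cos_sub_pi_div_two]

/-- The open half-planes bounded by the line through the `j`-th point contain at most as many
vertices as there are chosen, respectively not chosen, points among the next `n - 1` ones. -/
theorem ncard_normal_le [NeZero n] {θ : Fin n → ℝ} (hΘ : StrictMono (circAngle θ))
    (ε : Fin n → Bool) (j : ℕ) (s : Bool) :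
    Set.ncard {i : Fin n | 0 < dotp ((if s then 1 else -1 : ℝ) •
      pt (circAngle θ j + Real.pi / 2)) (vtx θ ε i)} ≤
      ((Finset.Ico (j + 1) (j + n)).filter (circSel ε · = s)).card := by
  classical
  refine le_trans (Set.ncard_le_ncard (t := ↑(((Finset.Ico (j + 1) (j + n)).filter
    (circSel ε · = s)).image (Fin.ofNat n))) ?_) ?_
  · intro i hi
    obtain ⟨m, hm, rfl⟩ := exists_mem_Ico_ofNat_eq j i
    rw [Finset.mem_Ico] at hm
    rw [Set.mem_ofPred_eq, dotp_vtx_pos_iff] at hi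
    have hmj : m ≠ j := by
      rintro rfl
      cases s <;> simp [dotp_neg_left, dotp_normal] at hi
    have hpos : 0 < Real.sin (circAngle θ m - circAngle θ j) := by
      have h1 : circAngle θ j < circAngle θ m := hΘ (by omega)
      have h2 : circAngle θ m < circAngle θ j + Real.pi := by
        rw [← circAngle_add]
        exact hΘ hm.2
      exact Real.sin_pos_of_pos_of_lt_pi (by linarith) (by linarith)
    refine Finset.mem_coe.2 (Finset.mem_image_of_mem _ (Finset.mem_filter.2
      ⟨Finset.mem_Ico.2 ⟨by omega, hm.2⟩, ?_⟩))
    cases s <;> cases hs : circSel ε m <;>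
      simp [hs, dotp_neg_left, dotp_normal, hpos] at hi ⊢
    all_goals linarith
  · rw [Set.ncard_coe_finset]
    exact Finset.card_image_le

theorem circSel_succ_of_thick [NeZero n] (hodd : Odd n) {θ : Fin n → ℝ}
    (hΘ : StrictMono (circAngle θ)) {ε : Fin n → Bool} (h : Thick θ ε) (j : ℕ) :
    circSel ε (j + 1) = !circSel ε j := by
  have hcard : ∀ j, ((Finset.Ico (j + 1) (j + n)).filter (circSel ε · = true)).card =
      (n - 1) / 2 := by
    intro j
    have h1 := (h _ (smul_ne_zero (by simp) (pt_ne_zero _))).trans (ncard_normal_le hΘ ε j true)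
    have h2 := (h _ (smul_ne_zero (by simp) (pt_ne_zero _))).trans (ncard_normal_le hΘ ε j false)
    have h3 := Finset.card_filter_add_card_filter_not (s := Finset.Ico (j + 1) (j + n))
      (circSel ε · = true)
    simp only [Bool.not_eq_true] at h3
    rw [Nat.card_Ico] at h3
    obtain ⟨k, hk⟩ := hodd
    omega
  have hn := NeZero.pos n
  have e1 := hcard j
  have e2 := hcard (j + 1)
  have e3 : ((Finset.Ico (j + 1) (j + 1 + n)).filter (circSel ε · = true)).card =
      (n - 1) / 2 + if circSel ε (j + n) then 1 else 0 := by
    rw [Finset.card_filter, add_right_comm, Finset.sum_Ico_succ_top (by omega),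
      ← Finset.card_filter, e1]
  rw [Finset.card_filter, Finset.sum_eq_sum_Ico_succ_bot (by omega), ← Finset.card_filter, e2,
    circSel_add] at e3
  revert e3
  cases circSel ε j <;> cases circSel ε (j + 1) <;> simp

theorem card_filter_Ico_of_alternating {c : ℕ → Bool} (hc : ∀ j, c (j + 1) = !c j) (j k : ℕ) :
    ((Finset.Ico j (j + 2 * k)).filter (c · = true)).card = k := by
  induction k with
  | zero => simp
  | succ k ih =>
    rw [Finset.card_filter, show j + 2 * (k + 1) = j + 2 * k + 1 + 1 by ring,
      Finset.sum_Ico_succ_top (by omega), Finset.sum_Ico_succ_top (by omega),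
      ← Finset.card_filter, ih, hc]
    cases c (j + 2 * k) <;> simp

theorem exists_polar_s10 (v : ℝ × ℝ) (hv : v ≠ 0) :
    ∃ r > 0, ∃ ψ : ℝ, v = (r : ℝ) • pt ψ := by
  refine ⟨‖(⟨v.1, v.2⟩ : ℂ)‖, norm_pos_iff.2 fun h => hv ?_, Complex.arg ⟨v.1, v.2⟩, ?_⟩
  · rw [Complex.ext_iff] at h
    exact Prod.ext h.1 h.2
  · ext
    · exact (Complex.norm_mul_cos_arg ⟨v.1, v.2⟩).symm
    · exact (Complex.norm_mul_sin_arg ⟨v.1, v.2⟩).symm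

theorem thick_of_alternating [NeZero n] (hodd : Odd n) {θ : Fin n → ℝ}
    (hΘ : StrictMono (circAngle θ)) {ε : Fin n → Bool}
    (hc : ∀ j, circSel ε (j + 1) = !circSel ε j) : Thick θ ε := by
  intro v hv
  have hn := NeZero.pos n
  obtain ⟨r, hr, ψ₀, rfl⟩ := exists_polar_s10 v hv
  obtain ⟨ψ, hψ, hpt⟩ : ∃ ψ, ψ - Real.pi / 2 ∈
      Set.Ico (circAngle θ 0) (circAngle θ 0 + 2 * Real.pi) ∧ pt ψ = pt ψ₀ := by
    obtain ⟨m, hm, -⟩ := existsUnique_add_zsmul_mem_Ico Real.two_pi_pos (ψ₀ - Real.pi / 2)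
      (circAngle θ 0)
    refine ⟨ψ₀ + m • (2 * Real.pi), ?_, ?_⟩
    · convert hm using 1
      ring
    · simp [pt]
  rw [← hpt]
  have hex : ∃ j, ψ - Real.pi / 2 < circAngle θ j := by
    refine ⟨n + n, ?_⟩
    have h := hψ.2
    have h1 := circAngle_add θ n
    have h0 := circAngle_add θ 0
    rw [zero_add] at h0
    linarith
  obtain ⟨j, hj, hjlt⟩ : ∃ j, circAngle θ j ≤ ψ - Real.pi / 2 ∧
      ψ - Real.pi / 2 < circAngle θ (j + 1) := by
    classical
    have h0 : Nat.find hex ≠ 0 := by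
      intro h
      have := Nat.find_spec hex
      rw [h] at this
      exact absurd hψ.1 (not_le.2 this)
    obtain ⟨j, hj⟩ := Nat.exists_eq_succ_of_ne_zero h0
    refine ⟨j, not_lt.1 (Nat.find_min hex (by omega)), ?_⟩
    have := Nat.find_spec hex
    rwa [hj] at this
  have hmem : ∀ m ∈ Finset.Ico (j + 1) (j + n), 0 < dotp (r • pt ψ) (pt (circAngle θ m)) := by
    intro m hm
    rw [Finset.mem_Ico] at hm
    have h1 : circAngle θ (j + 1) ≤ circAngle θ m := hΘ.monotone hm.1
    have h2 : circAngle θ m < circAngle θ j + Real.pi := by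
      rw [← circAngle_add]
      exact hΘ hm.2
    have h3 : dotp (r • pt ψ) (pt (circAngle θ m)) = r * Real.cos (circAngle θ m - ψ) := by
      rw [← dotp_pt_pt]
      simp only [dotp, Prod.smul_fst, Prod.smul_snd, smul_eq_mul]
      ring
    rw [h3]
    exact mul_pos hr (Real.cos_pos_of_mem_Ioo ⟨by linarith, by linarith⟩)
  obtain ⟨k, hk⟩ := hodd
  have hcard : ((Finset.Ico (j + 1) (j + n)).filter (circSel ε · = true)).card = (n - 1) / 2 := by
    rw [show j + n = j + 1 + 2 * k by omega, card_filter_Ico_of_alternating hc]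
    omega
  have hinj : Set.InjOn (Fin.ofNat n)
      ↑((Finset.Ico (j + 1) (j + n)).filter (circSel ε · = true)) := by
    intro a ha b hb hab
    simp only [Finset.coe_filter, Finset.mem_Ico, Set.mem_ofPred_eq] at ha hb
    refine Nat.mod_injOn_Ico j n ?_ ?_ (congrArg Fin.val hab)
    · exact Finset.mem_coe.2 (Finset.mem_Ico.2 (by omega))
    · exact Finset.mem_coe.2 (Finset.mem_Ico.2 (by omega))
  classical
  rw [← hcard, ← Finset.card_image_of_injOn hinj, ← Set.ncard_coe_finset]
  refine Set.ncard_le_ncard ?_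
  intro i hi
  obtain ⟨m, hm, rfl⟩ := Finset.mem_image.1 (Finset.mem_coe.1 hi)
  rw [Finset.mem_filter] at hm
  rw [Set.mem_ofPred_eq, dotp_vtx_pos_iff, if_pos hm.2]
  exact hmem m hm.1

/-! ### Comparison of areas -/

/-- The last term of the sequence `a` at an index that is at most `j` and selected by `c`. -/
def lastSel (a : ℕ → ℝ) (c : ℕ → Bool) : ℕ → ℝ
  | 0 => a 0
  | j + 1 => if c (j + 1) then a (j + 1) else lastSel a c j

theorem lastSel_of_sel (a : ℕ → ℝ) {c : ℕ → Bool} {j : ℕ} (h : c j) : lastSel a c j = a j := by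
  cases j with
  | zero => rfl
  | succ j => rw [lastSel, if_pos h]

theorem lastSel_succ_of_not_sel (a : ℕ → ℝ) {c : ℕ → Bool} {j : ℕ} (h : c (j + 1) = false) :
    lastSel a c (j + 1) = lastSel a c j := by
  rw [lastSel, if_neg (by simp [h])]

theorem lastSel_le {a : ℕ → ℝ} (ha : Monotone a) (c : ℕ → Bool) (j : ℕ) : lastSel a c j ≤ a j := by
  induction j with
  | zero => exact le_rfl
  | succ j ih =>
    rw [lastSel]
    split_ifs
    · exact le_rfl
    · exact ih.trans (ha j.le_succ)

theorem monotone_lastSel {a : ℕ → ℝ} (ha : Monotone a) (c : ℕ → Bool) :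
    Monotone (lastSel a c) := by
  refine monotone_nat_of_le_succ fun j => ?_
  rw [lastSel]
  split_ifs
  · exact (lastSel_le ha c j).trans (ha j.le_succ)
  · exact le_rfl

theorem exists_lastSel_eq (a : ℕ → ℝ) {c : ℕ → Bool} (h0 : c 0) (j : ℕ) :
    ∃ i ≤ j, c i ∧ lastSel a c j = a i := by
  induction j with
  | zero => exact ⟨0, le_rfl, h0, rfl⟩
  | succ j ih =>
    cases h : c (j + 1)
    · obtain ⟨i, hi, hc, he⟩ := ih
      exact ⟨i, by omega, hc, by rw [lastSel_succ_of_not_sel a h, he]⟩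
    · exact ⟨j + 1, le_rfl, h, lastSel_of_sel a h⟩

theorem sin_exchange (p x y z : ℝ) :
    Real.sin (y - p) + Real.sin (z - x) - (Real.sin (z - p) + Real.sin (y - x)) =
      4 * Real.sin ((x - p) / 2) * Real.sin ((z - y) / 2) * Real.sin ((y - p + (z - x)) / 2) := by
  obtain ⟨u, hu⟩ : ∃ u, u = (x - p) / 2 := ⟨_, rfl⟩
  obtain ⟨v, hv⟩ : ∃ v, v = (z - y) / 2 := ⟨_, rfl⟩
  obtain ⟨w, hw⟩ : ∃ w, w = (y - p + (z - x)) / 2 := ⟨_, rfl⟩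
  rw [← hu, ← hv, ← hw, show y - p = w + (u - v) by rw [hu, hv, hw]; ring,
    show z - x = w - (u - v) by rw [hu, hv, hw]; ring,
    show z - p = w + (u + v) by rw [hu, hv, hw]; ring,
    show y - x = w - (u + v) by rw [hu, hv, hw]; ring]
  simp only [Real.sin_add, Real.sin_sub, Real.cos_add, Real.cos_sub]
  ring

/-- The sum of the sines of the angles spanned by three consecutive points. -/
noncomputable def tripleSum (n : ℕ) (a : ℕ → ℝ) : ℝ :=
  ∑ j ∈ Finset.range n, Real.sin (a (j + 2) - a j)

/-- The excess of the gap before index `j + 1` over the elementary gap. -/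
noncomputable def gapExcess (a : ℕ → ℝ) (c : ℕ → Bool) (j : ℕ) : ℝ :=
  Real.sin (a (j + 1) - lastSel a c j) - Real.sin (a (j + 1) - a j)

theorem gapExcess_of_sel (a : ℕ → ℝ) {c : ℕ → Bool} {j : ℕ} (h : c j) : gapExcess a c j = 0 := by
  rw [gapExcess, lastSel_of_sel a h, sub_self]

theorem gap_add_gapExcess_of_sel (a : ℕ → ℝ) {c : ℕ → Bool} {j : ℕ} (h : c (j + 1)) :
    Real.sin (lastSel a c (j + 1) - lastSel a c j) + (gapExcess a c (j + 1) - gapExcess a c j) =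
      Real.sin (a (j + 1) - a j) := by
  rw [gapExcess_of_sel a h, gapExcess, lastSel_of_sel a h]
  ring

theorem gap_add_gapExcess_of_not_sel (a : ℕ → ℝ) {c : ℕ → Bool} {j : ℕ} (h : c (j + 1) = false) :
    Real.sin (lastSel a c (j + 1) - lastSel a c j) + (gapExcess a c (j + 1) - gapExcess a c j) =
      Real.sin (a (j + 2) - a j) - Real.sin (a (j + 2) - a (j + 1)) -
        4 * Real.sin ((a j - lastSel a c j) / 2) * Real.sin ((a (j + 2) - a (j + 1)) / 2) *
          Real.sin ((a (j + 1) - lastSel a c j + (a (j + 2) - a j)) / 2) := by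
  rw [← sin_exchange, gapExcess, gapExcess, lastSel_succ_of_not_sel a h, sub_self, Real.sin_zero]
  ring

/-- The value that the gap between consecutive selected points would contribute, up to
telescoping, in the alternating case. -/
noncomputable def gapBound (a : ℕ → ℝ) (c : ℕ → Bool) (j : ℕ) : ℝ :=
  if c (j + 1) then Real.sin (a (j + 1) - a j)
  else Real.sin (a (j + 2) - a j) - Real.sin (a (j + 2) - a (j + 1))

theorem sum_gapBound {n : ℕ} {a : ℕ → ℝ} (ha : ∀ j, a (j + n) = a j + Real.pi) {c : ℕ → Bool}
    (hc : ∀ j, c (j + n) = !c j) :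
    ∑ j ∈ Finset.range (2 * n), gapBound a c j = tripleSum n a := by
  have hpair : ∀ j, gapBound a c j + gapBound a c (n + j) = Real.sin (a (j + 2) - a j) -
      (Real.sin (a (j + 1 + 1) - a (j + 1)) - Real.sin (a (j + 1) - a j)) := by
    intro j
    have h0 := ha j
    have h1 := ha (j + 1)
    have h2 := ha (j + 2)
    have hc1 := hc (j + 1)
    simp only [gapBound, show n + j = j + n by ring, show j + n + 1 = j + 1 + n by ring,
      show j + n + 2 = j + 2 + n by ring, h0, h1, h2, hc1, add_sub_add_right_eq_sub]
    cases c (j + 1) <;> simp <;> ring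
  rw [two_mul, Finset.sum_range_add, ← Finset.sum_add_distrib,
    Finset.sum_congr rfl fun j _ => hpair j, Finset.sum_sub_distrib,
    Finset.sum_range_sub (fun j => Real.sin (a (j + 1) - a j)), tripleSum]
  have h1 := ha 1
  have h0 := ha 0
  rw [add_comm 1 n] at h1
  rw [zero_add] at h0
  simp [h0, h1]

theorem apply_two_mul {n : ℕ} {c : ℕ → Bool} (hc : ∀ j, c (j + n) = !c j) : c (2 * n) = c 0 := by
  have h := hc 0
  rw [zero_add] at h
  rw [two_mul, hc, h, Bool.not_not]

theorem sum_gap_eq {n : ℕ} {a : ℕ → ℝ} {c : ℕ → Bool} (h0 : c 0) (hn : c (2 * n)) :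
    ∑ j ∈ Finset.range (2 * n), Real.sin (lastSel a c (j + 1) - lastSel a c j) =
      ∑ j ∈ Finset.range (2 * n), (Real.sin (lastSel a c (j + 1) - lastSel a c j) +
        (gapExcess a c (j + 1) - gapExcess a c j)) := by
  rw [Finset.sum_add_distrib, Finset.sum_range_sub, gapExcess_of_sel a h0, gapExcess_of_sel a hn]
  ring

theorem sum_gap_of_alternating {n : ℕ} {a : ℕ → ℝ} (ha : ∀ j, a (j + n) = a j + Real.pi)
    {c : ℕ → Bool} (hc : ∀ j, c (j + n) = !c j) (h0 : c 0) (halt : ∀ j, c (j + 1) = !c j) :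
    ∑ j ∈ Finset.range (2 * n), Real.sin (lastSel a c (j + 1) - lastSel a c j) =
      tripleSum n a := by
  have hn : c (2 * n) := by rwa [apply_two_mul hc]
  rw [sum_gap_eq h0 hn, ← sum_gapBound ha hc]
  refine Finset.sum_congr rfl fun j _ => ?_
  cases h : c (j + 1)
  · have hj : c j = true := by simpa [h] using halt j
    rw [gap_add_gapExcess_of_not_sel a h, lastSel_of_sel a hj, gapBound, if_neg (by simp [h])]
    simp
  · rw [gap_add_gapExcess_of_sel a h, gapBound, if_pos h]

theorem sum_gap_lt {n : ℕ} (hn3 : 3 ≤ n) {a : ℕ → ℝ} (hmono : StrictMono a)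
    (ha : ∀ j, a (j + n) = a j + Real.pi) {c : ℕ → Bool} (hc : ∀ j, c (j + n) = !c j) (h0 : c 0)
    {i : ℕ} (hi : i < 2 * n) (hi0 : c i = false) (hi1 : c (i + 1) = false) :
    ∑ j ∈ Finset.range (2 * n), Real.sin (lastSel a c (j + 1) - lastSel a c j) <
      tripleSum n a := by
  have hn : c (2 * n) := by rwa [apply_two_mul hc]
  rw [sum_gap_eq h0 hn, ← sum_gapBound ha hc]
  have hlow : ∀ j, c (j + 1) = false → a (j + 1) - lastSel a c j ≤ Real.pi := by
    intro j hj
    rcases Nat.lt_or_ge (j + 1) n with h | h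
    · have h1 : a 0 ≤ lastSel a c j := monotone_lastSel hmono.monotone c (Nat.zero_le j)
      have h2 : a (j + 1) ≤ a (0 + n) := hmono.monotone (by omega)
      rw [ha] at h2
      linarith
    · obtain ⟨k, hk⟩ := Nat.exists_eq_add_of_le' h
      rw [hk, hc, Bool.not_eq_false'] at hj
      have h1 := monotone_lastSel hmono.monotone c (show k ≤ j by omega)
      rw [lastSel_of_sel a hj] at h1
      rw [hk, ha]
      linarith
  have hspan : ∀ j, a (j + 2) - a j < Real.pi := by
    intro j
    have : a (j + 2) < a (j + n) := hmono (by omega)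
    rw [ha] at this
    linarith
  have hpi := Real.pi_pos
  apply Finset.sum_lt_sum
  · intro j _
    cases h : c (j + 1)
    · rw [gap_add_gapExcess_of_not_sel a h, gapBound, if_neg (by simp [h])]
      have h1 := lastSel_le hmono.monotone c j
      have h2 : a j < a (j + 1) := hmono (by omega)
      have h3 : a (j + 1) < a (j + 2) := hmono (by omega)
      have h4 := hlow j h
      have h5 := hspan j
      have s1 : 0 ≤ Real.sin ((a j - lastSel a c j) / 2) :=
        Real.sin_nonneg_of_nonneg_of_le_pi (by linarith) (by linarith)
      have s2 : 0 ≤ Real.sin ((a (j + 2) - a (j + 1)) / 2) :=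
        Real.sin_nonneg_of_nonneg_of_le_pi (by linarith) (by linarith)
      have s3 : 0 ≤ Real.sin ((a (j + 1) - lastSel a c j + (a (j + 2) - a j)) / 2) :=
        Real.sin_nonneg_of_nonneg_of_le_pi (by linarith) (by linarith)
      rw [sub_le_self_iff]
      positivity
    · rw [gap_add_gapExcess_of_sel a h, gapBound, if_pos h]
  · refine ⟨i, Finset.mem_range.2 hi, ?_⟩
    rw [gap_add_gapExcess_of_not_sel a hi1, gapBound, if_neg (by simp [hi1])]
    have h1 : lastSel a c i < a i := by
      cases i with
      | zero => simp [h0] at hi0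
      | succ k =>
        rw [lastSel_succ_of_not_sel a hi0]
        exact (lastSel_le hmono.monotone c k).trans_lt (hmono k.lt_succ_self)
    have h2 : a i < a (i + 1) := hmono (by omega)
    have h3 : a (i + 1) < a (i + 2) := hmono (by omega)
    have h4 := hlow i hi1
    have h5 := hspan i
    have s1 : 0 < Real.sin ((a i - lastSel a c i) / 2) :=
      Real.sin_pos_of_pos_of_lt_pi (by linarith) (by linarith)
    have s2 : 0 < Real.sin ((a (i + 2) - a (i + 1)) / 2) :=
      Real.sin_pos_of_pos_of_lt_pi (by linarith) (by linarith)
    have s3 : 0 < Real.sin ((a (i + 1) - lastSel a c i + (a (i + 2) - a i)) / 2) :=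
      Real.sin_pos_of_pos_of_lt_pi (by linarith) (by linarith)
    rw [sub_lt_self_iff]
    positivity

theorem volume_apoly [NeZero n] {θ : Fin n → ℝ} (hΘ : StrictMono (circAngle θ))
    {ε : Fin n → Bool} (h0 : circSel ε 0) :
    0 ≤ (∑ j ∈ Finset.range (2 * n), Real.sin (lastSel (circAngle θ) (circSel ε) (j + 1) -
      lastSel (circAngle θ) (circSel ε) j)) / 2 ∧
    volume (apoly θ ε) = ENNReal.ofReal ((∑ j ∈ Finset.range (2 * n),
      Real.sin (lastSel (circAngle θ) (circSel ε) (j + 1) -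
        lastSel (circAngle θ) (circSel ε) j)) / 2) := by
  set φ := lastSel (circAngle θ) (circSel ε)
  have h2n : circSel ε (2 * n) := by rwa [apply_two_mul (circSel_add ε)]
  have hφ0 : φ 0 = circAngle θ 0 := rfl
  have hsel : ∀ j, circSel ε j → φ j = circAngle θ j := fun _ h => lastSel_of_sel _ h
  have hφ : φ (2 * n) = φ 0 + 2 * Real.pi := by
    have h1 := circAngle_add θ 0
    rw [zero_add] at h1
    rw [hφ0, hsel _ h2n, two_mul, circAngle_add, h1]
    ring
  have hset : pt '' (φ '' Set.Iic (2 * n)) = Set.range (vtx θ ε) := by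
    rw [range_vtx_eq]
    ext x
    constructor
    · rintro ⟨_, ⟨j, hj, rfl⟩, rfl⟩
      obtain ⟨i, hi, hc, he⟩ : ∃ i ≤ j, circSel ε i ∧ φ j = circAngle θ i :=
        exists_lastSel_eq (circAngle θ) h0 j
      rw [Set.mem_Iic] at hj
      rcases (hi.trans hj).lt_or_eq with h | h
      · exact ⟨i, h, hc, by rw [← he]⟩
      · refine ⟨0, by have := NeZero.pos n; omega, h0, ?_⟩
        have hi' : φ j = φ 0 + 2 * Real.pi := by
          rw [← hφ, he, h, hsel _ h2n]
        rw [hi', ← hφ0]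
        simp [pt]
    · rintro ⟨j, hj, hc, rfl⟩
      exact ⟨_, ⟨j, hj.le, rfl⟩, by rw [hsel _ hc]⟩
  have h := volume_convexHull_pt_image (monotone_lastSel hΘ.monotone (circSel ε)) (2 * n) hφ.le
  have hsin : Real.sin (φ 0 - φ (2 * n)) = 0 := by
    rw [hφ, sub_add_cancel_left, Real.sin_neg, Real.sin_two_pi, neg_zero]
  change 0 ≤ ((∑ j ∈ Finset.range (2 * n), Real.sin (φ (j + 1) - φ j)) +
    Real.sin (φ 0 - φ (2 * n))) / 2 ∧ volume (convexHull ℝ (pt '' (φ '' Set.Iic (2 * n)))) =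
      ENNReal.ofReal (((∑ j ∈ Finset.range (2 * n), Real.sin (φ (j + 1) - φ j)) +
        Real.sin (φ 0 - φ (2 * n))) / 2) at h
  rwa [hset, hsin, add_zero] at h

theorem vtx_not (θ : Fin n → ℝ) (ε : Fin n → Bool) (i : Fin n) :
    vtx θ (fun i => !ε i) i = -vtx θ ε i := by
  rw [vtx, vtx]
  cases ε i <;> simp

theorem apoly_not (θ : Fin n → ℝ) (ε : Fin n → Bool) :
    apoly θ (fun i => !ε i) = (fun x : ℝ × ℝ => -x) '' apoly θ ε := by
  rw [apoly, apoly, Set.image_neg_eq_neg, ← convexHull_neg]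
  congr 1
  ext x
  simp [vtx_not, neg_eq_iff_eq_neg]

theorem volume_apoly_not (θ : Fin n → ℝ) (ε : Fin n → Bool) :
    volume (apoly θ (fun i => !ε i)) = volume (apoly θ ε) := by
  rw [apoly_not, Set.image_neg_eq_neg, Measure.measure_neg]

theorem circSel_not [NeZero n] (ε : Fin n → Bool) (j : ℕ) :
    circSel (fun i => !ε i) j = !circSel ε j := by
  simp [circSel]

theorem volume_apoly_of_alternating [NeZero n] {θ : Fin n → ℝ} (hΘ : StrictMono (circAngle θ))
    {ε : Fin n → Bool} (hc : ∀ j, circSel ε (j + 1) = !circSel ε j) :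
    volume (apoly θ ε) = ENNReal.ofReal (tripleSum n (circAngle θ) / 2) := by
  wlog h0 : circSel ε 0 generalizing ε
  · rw [← volume_apoly_not]
    refine this (fun j => ?_) ?_
    · rw [circSel_not, circSel_not, hc]
    · simpa [circSel_not] using h0
  rw [(volume_apoly hΘ h0).2, sum_gap_of_alternating (circAngle_add θ) (circSel_add ε) h0 hc]

theorem exists_two_unselected [NeZero n] {ε : Fin n → Bool}
    (h : ¬ ∀ j, circSel ε (j + 1) = !circSel ε j) :
    ∃ j < 2 * n, circSel ε j = false ∧ circSel ε (j + 1) = false := by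
  by_contra! hne
  apply h
  have hlt : ∀ j < n, circSel ε (j + 1) = !circSel ε j := by
    intro j hj
    have h1 := hne j (by omega)
    have h2 := hne (j + n) (by omega)
    rw [add_right_comm, circSel_add, circSel_add] at h2
    revert h1 h2
    cases circSel ε j <;> cases circSel ε (j + 1) <;> simp
  intro j
  induction j using Nat.strong_induction_on with
  | _ j ih =>
    rcases Nat.lt_or_ge j n with hj | hj
    · exact hlt j hj
    · obtain ⟨k, rfl⟩ := Nat.exists_eq_add_of_le' hj
      have := NeZero.pos n
      rw [add_right_comm, circSel_add, circSel_add, ih k (by omega)]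

theorem volume_apoly_lt [NeZero n] (hodd : Odd n) {θ : Fin n → ℝ} (hΘ : StrictMono (circAngle θ))
    {ε : Fin n → Bool} (hc : ¬ ∀ j, circSel ε (j + 1) = !circSel ε j) :
    volume (apoly θ ε) < ENNReal.ofReal (tripleSum n (circAngle θ) / 2) := by
  wlog h0 : circSel ε 0 generalizing ε
  · rw [← volume_apoly_not]
    refine this (fun h => hc fun j => ?_) ?_
    · simpa [circSel_not] using h j
    · simpa [circSel_not] using h0
  have hn3 : 3 ≤ n := by
    by_contra! h
    have hn1 : n = 1 := by
      obtain ⟨k, hk⟩ := hodd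
      omega
    subst hn1
    exact hc (circSel_add ε)
  obtain ⟨i, hi, hi0, hi1⟩ := exists_two_unselected hc
  obtain ⟨hnn, hvol⟩ := volume_apoly hΘ h0
  rw [hvol, ENNReal.ofReal_lt_ofReal_iff_of_nonneg hnn]
  have := sum_gap_lt hn3 hΘ (circAngle_add θ) (circSel_add ε) h0 hi hi0 hi1
  linarith

theorem thick_iff_alternating [NeZero n] (hodd : Odd n) {θ : Fin n → ℝ}
    (hΘ : StrictMono (circAngle θ)) (ε : Fin n → Bool) :
    Thick θ ε ↔ ∀ j, circSel ε (j + 1) = !circSel ε j :=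
  ⟨circSel_succ_of_thick hodd hΘ, thick_of_alternating hodd hΘ⟩

theorem eq_of_alternating [NeZero n] {ε ε' : Fin n → Bool}
    (hc : ∀ j, circSel ε (j + 1) = !circSel ε j) (hc' : ∀ j, circSel ε' (j + 1) = !circSel ε' j)
    (h0 : circSel ε 0 = circSel ε' 0) : ε = ε' := by
  have h : ∀ j, circSel ε j = circSel ε' j := by
    intro j
    induction j with
    | zero => exact h0
    | succ j ih => rw [hc, hc', ih]
  ext i
  rw [← circSel_val ε, h, circSel_val]

theorem alternating_parity [NeZero n] (hodd : Odd n) (j : ℕ) :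
    circSel (fun i : Fin n => decide ((i : ℕ) % 2 = 0)) j = decide (j % 2 = 0) := by
  obtain ⟨k, hk⟩ := hodd
  have h : (n * (j / n) + j % n) % 2 = j % 2 := by rw [Nat.div_add_mod]
  rw [Nat.add_mod, Nat.mul_mod, show n % 2 = 1 by omega] at h
  simp only [circSel, Fin.val_ofNat]
  rcases Nat.mod_two_eq_zero_or_one (j / n) with h1 | h1 <;>
  rcases Nat.mod_two_eq_zero_or_one (j % n) with h2 | h2 <;>
  simp [h1, h2] at h ⊢ <;> omega

end Circular

/-- For n odd there are exactly two thick antipodal polygons, they are point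
reflections of each other through the origin, and every thick antipodal polygon
has strictly larger area than every non-thick one. -/
theorem stmt_10 (n : ℕ) (hodd : Odd n) (θ : Fin n → ℝ) (hmono : StrictMono θ)
    (hrange : ∀ i, θ i ∈ Set.Ico 0 Real.pi) :
    (∃ ε₁ ε₂ : Fin n → Bool, ε₁ ≠ ε₂ ∧ Thick θ ε₁ ∧ Thick θ ε₂ ∧
      (∀ ε : Fin n → Bool, Thick θ ε → ε = ε₁ ∨ ε = ε₂) ∧
      apoly θ ε₂ = (fun x : ℝ × ℝ => -x) '' apoly θ ε₁) ∧
    (∀ ε ε' : Fin n → Bool, Thick θ ε → ¬ Thick θ ε' →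
      volume (apoly θ ε') < volume (apoly θ ε)) := by
  have : NeZero n := ⟨by rintro rfl; simp at hodd⟩
  have hΘ := strictMono_circAngle hmono hrange
  have hpar : ∀ j, circSel (fun i : Fin n => decide ((i : ℕ) % 2 = 0)) (j + 1) =
      !circSel (fun i : Fin n => decide ((i : ℕ) % 2 = 0)) j := by
    intro j
    rw [alternating_parity hodd, alternating_parity hodd]
    rcases Nat.mod_two_eq_zero_or_one j with h | h <;> simp [Nat.add_mod, h]
  have hpar2 : ∀ j, circSel (fun i : Fin n => !decide ((i : ℕ) % 2 = 0)) (j + 1) =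
      !circSel (fun i : Fin n => !decide ((i : ℕ) % 2 = 0)) j := by
    intro j
    rw [circSel_not, circSel_not, hpar]
  refine ⟨⟨fun i => decide ((i : ℕ) % 2 = 0), fun i => !decide ((i : ℕ) % 2 = 0), ?_, ?_, ?_, ?_,
    apoly_not θ _⟩, ?_⟩
  · intro h
    simpa using congrFun h 0
  · exact (thick_iff_alternating hodd hΘ _).2 hpar
  · exact (thick_iff_alternating hodd hΘ _).2 hpar2
  · intro ε hε
    have hc := (thick_iff_alternating hodd hΘ _).1 hε
    cases h : circSel ε 0
    · refine Or.inr (eq_of_alternating hc hpar2 ?_)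
      rw [h, circSel_not, alternating_parity hodd]
      rfl
    · refine Or.inl (eq_of_alternating hc hpar ?_)
      rw [h, alternating_parity hodd]
      rfl
  · intro ε ε' hε hε'
    rw [thick_iff_alternating hodd hΘ] at hε hε'
    rw [volume_apoly_of_alternating hΘ hε]
    exact volume_apoly_lt hodd hΘ hε'
end

section
/- Let S be an antipodal point set of 2n points on the unit circle, n ≥ 3. An antipodal polygon on S of minimum area over all antipodal polygons on S is thin, and an antipodal polygon of maximum area is thick. -/
open MeasureTheory

/-- The determinant of the vectors `b - a` and `c - a`. -/
noncomputable def triDet (a b c : ℝ × ℝ) : ℝ :=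
  (b.1 - a.1) * (c.2 - a.2) - (b.2 - a.2) * (c.1 - a.1)

/-- The area of the standard triangle. -/
noncomputable def stdTriArea : ℝ :=
  volume.real (convexHull ℝ {((0 : ℝ), (0 : ℝ)), (1, 0), (0, 1)})

lemma volume_convexHull_lt_top {s : Set (ℝ × ℝ)} (hs : s.Finite) :
    volume (convexHull ℝ s) < ⊤ :=
  (hs.isCompact_convexHull (𝕜 := ℝ)).measure_lt_top

lemma stdTriArea_pos : 0 < stdTriArea := by
  have hfin := volume_convexHull_lt_top
    (s := {((0 : ℝ), (0 : ℝ)), (1, 0), (0, 1)}) (Set.toFinite _)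
  have hsub : Set.Icc (0 : ℝ) (1 / 2) ×ˢ Set.Icc (0 : ℝ) (1 / 2) ⊆
      convexHull ℝ {((0 : ℝ), (0 : ℝ)), (1, 0), (0, 1)} := by
    rintro ⟨x, y⟩ ⟨⟨hx0, hx1⟩, hy0, hy1⟩
    simp only at hx0 hx1 hy0 hy1
    rw [convexHull_insert (by simp), convexHull_pair]
    simp only [mem_convexJoin, Set.mem_singleton_iff, exists_eq_left]
    by_cases h : x + y = 0
    · refine ⟨(1, 0), left_mem_segment _ _ _, ?_⟩
      have : x = 0 := by linarith
      have : y = 0 := by linarith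
      subst x y
      exact left_mem_segment _ _ _
    · have hp : 0 < x + y := lt_of_le_of_ne (by linarith) (Ne.symm h)
      refine ⟨(x / (x + y), y / (x + y)), ⟨x / (x + y), y / (x + y), by positivity,
        by positivity, by field_simp, by simp⟩, 1 - (x + y), x + y, by linarith, hp.le, by ring, ?_⟩
      ext <;> simp <;> field_simp
  have hbox : volume (Set.Icc (0 : ℝ) (1 / 2) ×ˢ Set.Icc (0 : ℝ) (1 / 2)) ≠ 0 := by
    rw [Measure.volume_eq_prod, Measure.prod_prod]
    simp
  exact ENNReal.toReal_pos (fun h => hbox (measure_mono_null hsub h)) hfin.ne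

open scoped Pointwise in
lemma volume_real_triangle (a b c : ℝ × ℝ) :
    volume.real (convexHull ℝ {a, b, c}) = stdTriArea * |triDet a b c| := by
  let L : ℝ × ℝ →ₗ[ℝ] ℝ × ℝ := Matrix.toLin (Module.Basis.finTwoProd ℝ)
    (Module.Basis.finTwoProd ℝ) !![b.1 - a.1, c.1 - a.1; b.2 - a.2, c.2 - a.2]
  have hL : ∀ x, L x = ((b.1 - a.1) * x.1 + (c.1 - a.1) * x.2,
      (b.2 - a.2) * x.1 + (c.2 - a.2) * x.2) := fun x => Matrix.toLin_finTwoProd_apply _ _ _ _ x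
  have hdet : LinearMap.det L = triDet a b c := by
    simp only [L, LinearMap.det_toLin, Matrix.det_fin_two_of, triDet]
    ring
  have himg : convexHull ℝ {a, b, c} =
      (fun x => a + x) '' (L '' convexHull ℝ {((0 : ℝ), (0 : ℝ)), (1, 0), (0, 1)}) := by
    rw [LinearMap.image_convexHull]
    have : (fun x => a + x) '' convexHull ℝ (L '' {((0 : ℝ), (0 : ℝ)), (1, 0), (0, 1)}) =
        a +ᵥ convexHull ℝ (L '' {((0 : ℝ), (0 : ℝ)), (1, 0), (0, 1)}) := rfl
    rw [this, ← convexHull_vadd]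
    congr 1
    change _ = (fun x => a + x) '' _
    have hadd : ∀ p : ℝ × ℝ, a + (p.1 - a.1, p.2 - a.2) = p := fun p => by ext <;> simp
    simp only [Set.image_insert_eq, Set.image_singleton, hL, mul_zero, mul_one, add_zero, zero_add,
      hadd]
    rw [Prod.mk_zero_zero, add_zero]
  rw [himg, Measure.real, Set.image_add_left, measure_preimage_add,
    Measure.addHaar_image_linearMap, hdet, ENNReal.toReal_mul,
    ENNReal.toReal_ofReal (abs_nonneg _), mul_comm]
  rfl

lemma triDet_convex (a b x y : ℝ × ℝ) {u v : ℝ} (h : u + v = 1) :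
    triDet a b (u • x + v • y) = u * triDet a b x + v * triDet a b y := by
  obtain rfl : u = 1 - v := by linarith
  simp only [triDet, Prod.fst_add, Prod.snd_add, Prod.smul_fst, Prod.smul_snd, smul_eq_mul]
  ring

lemma convex_triDet_nonpos (a b : ℝ × ℝ) : Convex ℝ {z | triDet a b z ≤ 0} := by
  intro x hx y hy u v hu hv huv
  simp only [Set.mem_ofPred_eq] at hx hy ⊢
  rw [triDet_convex a b x y huv]
  nlinarith

lemma convex_triDet_nonneg (a b : ℝ × ℝ) : Convex ℝ {z | 0 ≤ triDet a b z} := by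
  intro x hx y hy u v hu hv huv
  simp only [Set.mem_ofPred_eq] at hx hy ⊢
  rw [triDet_convex a b x y huv]
  positivity

lemma convex_unitDisk : Convex ℝ {z : ℝ × ℝ | z.1 ^ 2 + z.2 ^ 2 ≤ 1} := by
  rintro ⟨a, b⟩ hx ⟨c, d⟩ hy u v hu hv huv
  obtain rfl : u = 1 - v := by linarith
  simp only [Set.mem_ofPred_eq, Prod.fst_add, Prod.snd_add, Prod.smul_fst, Prod.smul_snd,
    smul_eq_mul] at *
  nlinarith [mul_nonneg (mul_nonneg hu hv) (sq_nonneg (a - c)),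
    mul_nonneg (mul_nonneg hu hv) (sq_nonneg (b - d))]

lemma mem_segment_of_chord {a b w : ℝ × ℝ} (ha : a.1 ^ 2 + a.2 ^ 2 = 1)
    (hb : b.1 ^ 2 + b.2 ^ 2 = 1) (hab : a ≠ b) (hw : w.1 ^ 2 + w.2 ^ 2 ≤ 1)
    (h0 : triDet a b w = 0) : w ∈ segment ℝ a b := by
  obtain ⟨a₁, a₂⟩ := a
  obtain ⟨b₁, b₂⟩ := b
  obtain ⟨w₁, w₂⟩ := w
  simp only [triDet] at ha hb hw h0
  have hD : 0 < (b₁ - a₁) ^ 2 + (b₂ - a₂) ^ 2 := by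
    by_contra! h
    have h1 : b₁ - a₁ = 0 := by nlinarith [sq_nonneg (b₁ - a₁), sq_nonneg (b₂ - a₂)]
    have h2 : b₂ - a₂ = 0 := by nlinarith [sq_nonneg (b₁ - a₁), sq_nonneg (b₂ - a₂)]
    exact hab (by ext <;> simp only <;> linarith)
  set D := (b₁ - a₁) ^ 2 + (b₂ - a₂) ^ 2 with hDdef
  obtain ⟨s, hs⟩ : ∃ s, s * D = (w₁ - a₁) * (b₁ - a₁) + (w₂ - a₂) * (b₂ - a₂) :=
    ⟨_, div_mul_cancel₀ _ hD.ne'⟩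
  have e1 : w₁ = a₁ + s * (b₁ - a₁) := by
    apply mul_left_cancel₀ hD.ne'
    linear_combination (-(b₂ - a₂)) * h0 - (b₁ - a₁) * hs + (w₁ - a₁) * hDdef
  have e2 : w₂ = a₂ + s * (b₂ - a₂) := by
    apply mul_left_cancel₀ hD.ne'
    linear_combination (b₁ - a₁) * h0 - (b₂ - a₂) * hs + (w₂ - a₂) * hDdef
  have key : s * (s - 1) * D ≤ 0 := by
    have : s * (s - 1) * D = w₁ ^ 2 + w₂ ^ 2 - 1 := by
      rw [e1, e2, hDdef]
      linear_combination (s - 1) * ha - s * hb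
    linarith
  have key2 : s * (s - 1) ≤ 0 := by
    by_contra! h
    nlinarith [mul_pos h hD]
  refine ⟨1 - s, s, by nlinarith, by nlinarith, by ring, ?_⟩
  ext <;> simp [e1, e2] <;> ring

lemma volume_real_convexHull_insert {s : Set (ℝ × ℝ)} {a b c : ℝ × ℝ} (hs : s.Finite)
    (hunit : ∀ z ∈ insert c s, z.1 ^ 2 + z.2 ^ 2 = 1) (ha : a ∈ s) (hb : b ∈ s)
    (hside : ∀ z ∈ s, triDet a b z ≤ 0) (hc : 0 < triDet a b c) :
    volume.real (convexHull ℝ (insert c s)) =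
      volume.real (convexHull ℝ s) + stdTriArea * triDet a b c := by
  have hab : a ≠ b := by
    rintro rfl
    simp [triDet] at hc
  have hau := hunit a (Or.inr ha)
  have hbu := hunit b (Or.inr hb)
  have hH : convexHull ℝ s ⊆ {z | triDet a b z ≤ 0} :=
    convexHull_min hside (convex_triDet_nonpos a b)
  have hT : convexHull ℝ {a, b, c} ⊆ {z | 0 ≤ triDet a b z} := by
    refine convexHull_min ?_ (convex_triDet_nonneg a b)
    rintro z (rfl | rfl | rfl)
    · simp [triDet]
    · simp [triDet, mul_comm]
    · exact hc.le
  have hdisk : convexHull ℝ (insert c s) ⊆ {z | z.1 ^ 2 + z.2 ^ 2 ≤ 1} :=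
    convexHull_min (fun z hz => (hunit z hz).le) convex_unitDisk
  have hHsub : convexHull ℝ s ⊆ convexHull ℝ (insert c s) :=
    convexHull_mono (Set.subset_insert _ _)
  have hTsub : convexHull ℝ {a, b, c} ⊆ convexHull ℝ (insert c s) := by
    apply convexHull_mono
    rintro z (rfl | rfl | rfl) <;> simp [ha, hb]
  have hsegH : segment ℝ a b ⊆ convexHull ℝ s := segment_subset_convexHull ha hb
  have hsegT : segment ℝ a b ⊆ convexHull ℝ {a, b, c} :=
    segment_subset_convexHull (by simp) (by simp)
  have hunion : convexHull ℝ (insert c s) = convexHull ℝ s ∪ convexHull ℝ {a, b, c} := by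
    refine Set.Subset.antisymm ?_ (Set.union_subset hHsub hTsub)
    intro z hz
    have hz' := hz
    rw [convexHull_insert ⟨a, ha⟩] at hz
    simp only [mem_convexJoin, Set.mem_singleton_iff, exists_eq_left] at hz
    obtain ⟨h, hh, hzh⟩ := hz
    have hLh : triDet a b h ≤ 0 := hH hh
    have hcH : c ∈ convexHull ℝ (insert c s) := subset_convexHull _ _ (by simp)
    have hden : 0 < triDet a b c - triDet a b h := by linarith
    set u := -triDet a b h / (triDet a b c - triDet a b h) with hu
    set v := triDet a b c / (triDet a b c - triDet a b h) with hv
    have huv : u + v = 1 := by rw [hu, hv]; field_simp; ring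
    have hu0 : 0 ≤ u := div_nonneg (by linarith) hden.le
    have hv0 : 0 ≤ v := div_nonneg hc.le hden.le
    set w := u • c + v • h with hw
    have hwseg : w ∈ segment ℝ c h := ⟨u, v, hu0, hv0, huv, rfl⟩
    have hw0 : triDet a b w = 0 := by
      rw [hw, triDet_convex _ _ _ _ huv, hu, hv]
      field_simp
      ring
    have hwH : w ∈ convexHull ℝ (insert c s) :=
      (convex_convexHull ℝ _).segment_subset hcH (hHsub hh) hwseg
    have hwab := mem_segment_of_chord hau hbu hab (hdisk hwH) hw0
    rw [← insert_endpoints_openSegment] at hzh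
    have hcT : c ∈ convexHull ℝ {a, b, c} := subset_convexHull _ _ (by simp)
    rcases hzh with rfl | rfl | hzh
    · exact Or.inr hcT
    · exact Or.inl hh
    · have hwr : w ∈ Set.range (AffineMap.lineMap c h : ℝ → ℝ × ℝ) := by
        rw [segment_eq_image_lineMap] at hwseg
        obtain ⟨r, -, hr⟩ := hwseg
        exact ⟨r, hr⟩
      rcases openSegment_subset_union c h hwr hzh with rfl | hz1 | hz1
      · exact Or.inl (hsegH hwab)
      · exact Or.inr ((convex_convexHull ℝ _).openSegment_subset hcT (hsegT hwab) hz1)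
      · exact Or.inl ((convex_convexHull ℝ _).openSegment_subset (hsegH hwab) hh hz1)
  have hinter : volume.real (convexHull ℝ s ∩ convexHull ℝ {a, b, c}) = 0 := by
    have hsub : convexHull ℝ s ∩ convexHull ℝ {a, b, c} ⊆ convexHull ℝ {a, a, b} := by
      rintro z ⟨hz1, hz2⟩
      have := mem_segment_of_chord hau hbu hab (hdisk (hHsub hz1)) (le_antisymm (hH hz1) (hT hz2))
      simpa [convexHull_pair] using this
    refine le_antisymm ?_ measureReal_nonneg
    refine (measureReal_mono hsub (volume_convexHull_lt_top (Set.toFinite _)).ne).trans ?_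
    rw [volume_real_triangle]
    simp [triDet]
  have hmeas : MeasurableSet (convexHull ℝ {a, b, c}) :=
    ((Set.toFinite {a, b, c}).isCompact_convexHull (𝕜 := ℝ)).measurableSet
  have := measureReal_union_add_inter (μ := volume) (s := convexHull ℝ s) hmeas
    (volume_convexHull_lt_top hs).ne (volume_convexHull_lt_top (Set.toFinite _)).ne
  rw [hinter, add_zero, ← hunion, volume_real_triangle, abs_of_pos hc] at this
  exact this

lemma triDet_pt (α β γ : ℝ) : triDet (pt α) (pt β) (pt γ) =
    Real.sin (β - α) + Real.sin (γ - β) + Real.sin (α - γ) := by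
  simp only [triDet, pt, Real.sin_sub]
  ring

lemma sin_triple_product (x y : ℝ) : Real.sin x + Real.sin y - Real.sin (x + y) =
    4 * Real.sin (x / 2) * Real.sin (y / 2) * Real.sin (x / 2 + y / 2) := by
  obtain ⟨u, rfl⟩ : ∃ u, x = 2 * u := ⟨x / 2, by ring⟩
  obtain ⟨v, rfl⟩ : ∃ v, y = 2 * v := ⟨y / 2, by ring⟩
  rw [← mul_add]
  simp only [Real.sin_two_mul, mul_div_cancel_left₀ _ (two_ne_zero' ℝ), Real.sin_add, Real.cos_add]
  linear_combination -(2 * Real.sin u * Real.cos u) * Real.sin_sq_add_cos_sq v -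
    (2 * Real.sin v * Real.cos v) * Real.sin_sq_add_cos_sq u

lemma triDet_pt_pos {α β γ : ℝ} (h1 : α < β) (h2 : β < γ) (h3 : γ < α + 2 * Real.pi) :
    0 < triDet (pt α) (pt β) (pt γ) := by
  have : triDet (pt α) (pt β) (pt γ) = Real.sin (β - α) + Real.sin (γ - β) -
      Real.sin ((β - α) + (γ - β)) := by
    rw [triDet_pt, sub_eq_add_neg _ (Real.sin _), ← Real.sin_neg]
    ring_nf
  rw [this, sin_triple_product]
  have e1 : 0 < Real.sin ((β - α) / 2) :=
    Real.sin_pos_of_pos_of_lt_pi (by linarith) (by linarith)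
  have e2 : 0 < Real.sin ((γ - β) / 2) :=
    Real.sin_pos_of_pos_of_lt_pi (by linarith) (by linarith)
  have e3 : 0 < Real.sin ((β - α) / 2 + (γ - β) / 2) :=
    Real.sin_pos_of_pos_of_lt_pi (by linarith) (by linarith)
  positivity

lemma pt_unit (τ : ℝ) : (pt τ).1 ^ 2 + (pt τ).2 ^ 2 = 1 := by
  simp [pt]

/-- Area of a polygon inscribed in the unit circle, with vertices listed in circular order. -/
lemma volume_real_inscribed (u : ℕ → ℝ) (hu : StrictMono u) (m : ℕ)
    (hm : u (m + 1) < u 0 + 2 * Real.pi) :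
    volume.real (convexHull ℝ ((fun i => pt (u i)) '' Set.Iic (m + 1))) =
      stdTriArea * (∑ i ∈ Finset.range (m + 1), Real.sin (u (i + 1) - u i) +
        Real.sin (u 0 - u (m + 1))) := by
  induction m with
  | zero =>
    have : (fun i => pt (u i)) '' Set.Iic (0 + 1) = {pt (u 0), pt (u 0), pt (u 1)} := by
      ext z
      simp only [Set.mem_image, Set.mem_Iic, Set.mem_insert_iff, Set.mem_singleton_iff]
      constructor
      · rintro ⟨i, hi, rfl⟩
        interval_cases i <;> simp
      · rintro (rfl | rfl | rfl)
        exacts [⟨0, by simp⟩, ⟨0, by simp⟩, ⟨1, by simp⟩]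
    rw [this, volume_real_triangle]
    have h2 : Real.sin (u 0 - u 1) = -Real.sin (u 1 - u 0) := by
      rw [← Real.sin_neg]; ring_nf
    simp [triDet, h2]
  | succ m ih =>
    have hlt : u (m + 1) < u (m + 1 + 1) := hu (by omega)
    specialize ih (by linarith)
    have hins : (fun i => pt (u i)) '' Set.Iic (m + 1 + 1) =
        insert (pt (u (m + 1 + 1))) ((fun i => pt (u i)) '' Set.Iic (m + 1)) := by
      refine Eq.trans ?_ (Set.image_insert_eq (f := fun i => pt (u i)))
      congr 1
      ext i
      simp only [Set.mem_Iic, Set.mem_insert_iff]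
      omega
    rw [hins, volume_real_convexHull_insert (a := pt (u 0)) (b := pt (u (m + 1)))
      ((Set.finite_Iic _).image _) ?_ ⟨0, by simp⟩ ⟨m + 1, by simp⟩ ?_
      (triDet_pt_pos (hu (by omega)) hlt hm), ih, triDet_pt, Finset.sum_range_succ _ (m + 1)]
    · have : Real.sin (u 0 - u (m + 1)) = -Real.sin (u (m + 1) - u 0) := by
        rw [← Real.sin_neg]; ring_nf
      rw [this]
      ring
    · rw [← hins]
      rintro _ ⟨i, -, rfl⟩
      exact pt_unit _
    · rintro _ ⟨i, hi, rfl⟩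
      simp only [Set.mem_Iic] at hi
      rcases Nat.eq_zero_or_pos i with rfl | hi0
      · simp [triDet]
      rcases hi.eq_or_lt with rfl | hi1
      · simp [triDet, mul_comm]
      have := triDet_pt_pos (hu hi0) (hu hi1) (by linarith)
      have e : triDet (pt (u 0)) (pt (u (m + 1))) (pt (u i)) =
          -triDet (pt (u 0)) (pt (u i)) (pt (u (m + 1))) := by
        simp only [triDet]; ring
      linarith

open Classical in
/-- For a set `T` of edges of a closed chain (edge `j` joins points `j` and `j + 1`), the arc
starting at `j` ends at `j + 1` if `j ∉ T`, and at the endpoint of the next edge of `T`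
otherwise. -/
noncomputable def arcEnd (T : ℕ → Prop) (j : ℕ) : ℕ :=
  if T j then sInf {k | j < k ∧ T k} + 1 else j + 1

/-- The sum of the sines of the arcs determined by `T` over one period. -/
noncomputable def arcSum (n : ℕ) (t : ℕ → ℝ) (T : ℕ → Prop) : ℝ :=
  ∑ j ∈ Finset.range n, Real.sin (t (arcEnd T j) - t j)

lemma arcEnd_of_not {T : ℕ → Prop} {j : ℕ} (h : ¬T j) : arcEnd T j = j + 1 := if_neg h

lemma arcEnd_eq {T : ℕ → Prop} {j k : ℕ} (hj : T j) (hjk : j < k) (hk : T k)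
    (hno : ∀ i, j < i → i < k → ¬T i) : arcEnd T j = k + 1 := by
  rw [arcEnd, if_pos hj]
  congr 1
  refine le_antisymm (Nat.sInf_le ⟨hjk, hk⟩) (le_csInf ⟨k, hjk, hk⟩ ?_)
  rintro i ⟨hi, hTi⟩
  by_contra! h
  exact hno i hi h hTi

lemma exists_next {T : ℕ → Prop} {n : ℕ} (hn : 0 < n) (hT : ∀ j, T (j + n) ↔ T j) {j : ℕ}
    (hj : T j) : ∃ k, j < k ∧ k ≤ j + n ∧ T k ∧ ∀ i, j < i → i < k → ¬T i := by
  have hne : {k | j < k ∧ T k}.Nonempty := ⟨j + n, by omega, (hT j).2 hj⟩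
  obtain ⟨h1, h2⟩ : _ ∧ _ := Nat.sInf_mem hne
  refine ⟨_, h1, Nat.sInf_le ⟨by omega, (hT j).2 hj⟩, h2, fun i hi hik hTi => ?_⟩
  exact absurd (Nat.sInf_le (s := {k | j < k ∧ T k}) ⟨hi, hTi⟩) (by omega)

lemma arcEnd_add_period {T : ℕ → Prop} {n : ℕ} (hn : 0 < n) (hT : ∀ j, T (j + n) ↔ T j)
    (j : ℕ) : arcEnd T (j + n) = arcEnd T j + n := by
  by_cases hj : T j
  · obtain ⟨k, hjk, -, hk, hno⟩ := exists_next hn hT hj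
    rw [arcEnd_eq hj hjk hk hno, arcEnd_eq (k := k + n) ((hT j).2 hj) (by omega) ((hT k).2 hk)]
    · omega
    · intro i h1 h2 h3
      obtain ⟨i, rfl⟩ : ∃ i', i = i' + n := ⟨i - n, by omega⟩
      exact hno i (by omega) (by omega) ((hT i).1 h3)
  · rw [arcEnd_of_not hj, arcEnd_of_not (fun h => hj ((hT j).1 h))]
    omega

lemma sum_Ico_period {n : ℕ} {g : ℕ → ℝ} (hg : ∀ j, g (j + n) = g j) (c : ℕ) :
    ∑ j ∈ Finset.Ico c (c + n), g j = ∑ j ∈ Finset.range n, g j := by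
  induction c with
  | zero => rw [zero_add, Finset.range_eq_Ico]
  | succ c ih =>
    rw [← ih]
    rcases Nat.eq_zero_or_pos n with rfl | hn
    · simp
    rw [Finset.sum_eq_sum_Ico_succ_bot (by omega : c < c + n),
      show c + 1 + n = c + n + 1 by omega, Finset.sum_Ico_succ_top (by omega), hg, add_comm]

lemma exists_mem_window {T : ℕ → Prop} {n : ℕ} (hn : 0 < n) (hT : ∀ j, T (j + n) ↔ T j)
    (hne : ∃ j, T j) (c : ℕ) : ∃ j, c ≤ j ∧ j < c + n ∧ T j := by
  induction c with
  | zero =>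
    obtain ⟨j, hj⟩ := hne
    refine ⟨j % n, by omega, by simpa using Nat.mod_lt j hn, ?_⟩
    have hper : Function.Periodic T n := fun j => propext (hT j)
    rwa [hper.map_mod_nat]
  | succ c ih =>
    obtain ⟨j, h1, h2, h3⟩ := ih
    rcases h1.eq_or_lt with rfl | h
    · exact ⟨c + n, by omega, by omega, (hT c).2 h3⟩
    · exact ⟨j, by omega, by omega, h3⟩

lemma eq_of_mod_eq_of_lt {n i j : ℕ} (h : i % n = j % n) (h1 : i < j + n) (h2 : j < i + n) :
    i = j := by
  rcases le_total i j with hij | hij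
  · have := Nat.eq_zero_of_dvd_of_lt ((Nat.modEq_iff_dvd' hij).1 h) (by omega)
    omega
  · have := Nat.eq_zero_of_dvd_of_lt ((Nat.modEq_iff_dvd' hij).1 (Eq.symm h)) (by omega)
    omega

lemma sin_add_sin_lt {x y z : ℝ} (hx : 0 < x) (hy : 0 < y) (hz : 0 < z)
    (h : x + 2 * y + z < 2 * Real.pi) :
    Real.sin y + Real.sin (x + y + z) < Real.sin (x + y) + Real.sin (y + z) := by
  have e : Real.sin (x + y) + Real.sin (y + z) - Real.sin y - Real.sin (x + y + z) =
      4 * Real.sin (x / 2) * Real.sin (z / 2) * Real.sin (x / 2 + y + z / 2) := by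
    obtain ⟨u, rfl⟩ : ∃ u, x = 2 * u := ⟨x / 2, by ring⟩
    obtain ⟨v, rfl⟩ : ∃ v, z = 2 * v := ⟨z / 2, by ring⟩
    simp only [mul_div_cancel_left₀ _ (two_ne_zero' ℝ), Real.sin_add, Real.cos_add,
      Real.sin_two_mul, Real.cos_two_mul']
    have h1 := Real.sin_sq_add_cos_sq u
    have h2 := Real.sin_sq_add_cos_sq v
    have c1 : Real.cos u ^ 2 = 1 - Real.sin u ^ 2 := by linarith
    have c2 : Real.cos v ^ 2 = 1 - Real.sin v ^ 2 := by linarith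
    ring_nf
    simp only [c1, c2]
    ring
  have e1 : 0 < Real.sin (x / 2) := Real.sin_pos_of_pos_of_lt_pi (by linarith) (by linarith)
  have e2 : 0 < Real.sin (z / 2) := Real.sin_pos_of_pos_of_lt_pi (by linarith) (by linarith)
  have e3 : 0 < Real.sin (x / 2 + y + z / 2) :=
    Real.sin_pos_of_pos_of_lt_pi (by linarith) (by linarith)
  have : 0 < 4 * Real.sin (x / 2) * Real.sin (z / 2) * Real.sin (x / 2 + y + z / 2) := by
    positivity
  linarith

/-- Adding one edge to a nonempty edge set strictly increases the arc sum. -/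
lemma arcSum_lt_of_insert {n : ℕ} (hn : 3 ≤ n) {t : ℕ → ℝ} (ht : StrictMono t)
    (htn : ∀ j, t (j + n) = t j + Real.pi) {T T' : ℕ → Prop} (hT : ∀ j, T (j + n) ↔ T j)
    (hne : ∃ j, T j) {e : ℕ} (he : ¬T e) (hT' : ∀ j, T' j ↔ T j ∨ j % n = e % n) :
    arcSum n t T < arcSum n t T' := by
  classical
  have hn0 : 0 < n := by omega
  have hTn' : ∀ j, T' (j + n) ↔ T' j := fun j => by rw [hT', hT', hT, Nat.add_mod_right]
  obtain ⟨E, hE⟩ : ∃ E, E = e + n := ⟨_, rfl⟩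
  have hEmod : E % n = e % n := by rw [hE, Nat.add_mod_right]
  have hTE : ¬T E := by rwa [hE, hT]
  obtain ⟨p, hpe, hpE, hp, hpmax⟩ :
      ∃ p, E < p + n ∧ p < E ∧ T p ∧ ∀ i, p < i → i < E → ¬T i := by
    obtain ⟨j, h1, h2, h3⟩ := exists_mem_window hn0 hT hne e
    have hje : j ≠ e := fun h => he (h ▸ h3)
    have hle := Nat.le_findGreatest (P := T) (show j ≤ E - 1 by omega) h3
    have hle' := Nat.findGreatest_le (P := T) (E - 1)
    refine ⟨Nat.findGreatest T (E - 1), by omega, by omega,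
      Nat.findGreatest_spec (show j ≤ E - 1 by omega) h3, fun i hi1 hi2 => ?_⟩
    exact Nat.findGreatest_is_greatest hi1 (by omega)
  obtain ⟨q, hpq, hqn, hq, hqmin⟩ := exists_next hn0 hT hp
  have hEq : E < q := by
    rcases lt_trichotomy q E with h | h | h
    · exact absurd hq (hpmax q hpq h)
    · exact absurd (h ▸ hq) hTE
    · exact h
  have hE' : T' E := (hT' E).2 (Or.inr hEmod)
  have hnot' : ∀ i, ¬T i → i < E + n → E < i + n → i ≠ E → ¬T' i := by
    intro i h1 h2 h3 h4 h5
    rcases (hT' i).1 h5 with h | h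
    · exact h1 h
    · exact h4 (eq_of_mod_eq_of_lt (h.trans hEmod.symm) h2 h3)
  have vp : arcEnd T p = q + 1 := arcEnd_eq hp hpq hq hqmin
  have vE : arcEnd T E = E + 1 := arcEnd_of_not hTE
  have vp' : arcEnd T' p = E + 1 := arcEnd_eq ((hT' p).2 (Or.inl hp)) hpE hE'
    fun i h1 h2 => hnot' i (hpmax i h1 h2) (by omega) (by omega) (by omega)
  have vE' : arcEnd T' E = q + 1 := arcEnd_eq hE' hEq ((hT' q).2 (Or.inl hq))
    fun i h1 h2 => hnot' i (hqmin i (by omega) h2) (by omega) (by omega) (by omega)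
  have vother : ∀ j ∈ Finset.Ico p (p + n), j ≠ p ∧ j ≠ E → arcEnd T' j = arcEnd T j := by
    rintro j hj ⟨hjp, hjE⟩
    rw [Finset.mem_Ico] at hj
    by_cases hTj : T j
    · have hEj : E < j := by
        by_contra! h
        exact hpmax j (by omega) (by omega) hTj
      obtain ⟨k, hjk, -, hk, hkmin⟩ := exists_next hn0 hT hTj
      have hkp : k ≤ p + n := by
        by_contra! h
        exact hkmin (p + n) (by omega) h ((hT p).2 hp)
      rw [arcEnd_eq hTj hjk hk hkmin, arcEnd_eq ((hT' j).2 (Or.inl hTj)) hjk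
        ((hT' k).2 (Or.inl hk))]
      exact fun i h1 h2 => hnot' i (hkmin i h1 h2) (by omega) (by omega) (by omega)
    · rw [arcEnd_of_not hTj, arcEnd_of_not (hnot' j hTj (by omega) (by omega) hjE)]
  have hper : ∀ {S : ℕ → Prop}, (∀ j, S (j + n) ↔ S j) → ∀ j,
      Real.sin (t (arcEnd S (j + n)) - t (j + n)) = Real.sin (t (arcEnd S j) - t j) := by
    intro S hS j
    rw [arcEnd_add_period hn0 hS, htn, htn, add_sub_add_right_eq_sub]
  rw [arcSum, arcSum, ← sum_Ico_period (hper hT) p, ← sum_Ico_period (hper hTn') p, ← sub_pos,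
    ← Finset.sum_sub_distrib, Finset.sum_eq_add p E (by omega)
      (fun j hj h => by rw [vother j hj h, sub_self])
      (fun h => absurd (Finset.mem_Ico.2 ⟨le_rfl, by omega⟩) h)
      (fun h => absurd (Finset.mem_Ico.2 ⟨by omega, by omega⟩) h), vp, vE, vp', vE']
  have m1 := ht hpE
  have m2 := ht (Nat.lt_succ_self E)
  have m3 := ht (show E + 1 < q + 1 by omega)
  have m4 := ht.monotone (show q + 1 ≤ p + 1 + n by omega)
  have m5 := ht.monotone (show E + 1 ≤ p + n by omega)
  rw [htn] at m4 m5
  have m6 : t (E + 1) - t E + (t (p + 1) - t p) < Real.pi := by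
    rcases (show p + 1 ≤ E by omega).eq_or_lt with h | h
    · have := ht (show E + 1 < p + n by omega)
      rw [htn] at this
      rw [h]
      linarith
    · have := ht h
      linarith
  have key := sin_add_sin_lt (x := t E - t p) (y := t (E + 1) - t E) (z := t (q + 1) - t (E + 1))
    (by linarith) (by linarith) (by linarith) (by linarith)
  rw [show t E - t p + (t (E + 1) - t E) + (t (q + 1) - t (E + 1)) = t (q + 1) - t p by ring,
    show t E - t p + (t (E + 1) - t E) = t (E + 1) - t p by ring,
    show t (E + 1) - t E + (t (q + 1) - t (E + 1)) = t (q + 1) - t E by ring] at key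
  linarith

/-- The arc sum is strictly monotone in the (periodic, nonempty) edge set. -/
lemma arcSum_lt_of_ssubset {n : ℕ} (hn : 3 ≤ n) {t : ℕ → ℝ} (ht : StrictMono t)
    (htn : ∀ j, t (j + n) = t j + Real.pi) {s s' : Finset ℕ} (hs' : s' ⊆ Finset.range n)
    (hne : s.Nonempty) (hss : s ⊂ s') :
    arcSum n t (fun j => j % n ∈ s) < arcSum n t (fun j => j % n ∈ s') := by
  have step : ∀ r : Finset ℕ, r ⊆ Finset.range n → r.Nonempty → ∀ e < n, e ∉ r →
      arcSum n t (fun j => j % n ∈ r) < arcSum n t (fun j => j % n ∈ insert e r) := by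
    intro r hr ⟨a, ha⟩ e hen her
    have han := Finset.mem_range.1 (hr ha)
    refine arcSum_lt_of_insert hn ht htn (fun j => by rw [Nat.add_mod_right])
      ⟨a, by rwa [Nat.mod_eq_of_lt han]⟩ (e := e) (by rwa [Nat.mod_eq_of_lt hen]) (fun j => ?_)
    rw [Finset.mem_insert, or_comm, Nat.mod_eq_of_lt hen]
  induction s' using Finset.strongInduction with
  | H s' ih =>
    obtain ⟨e, he, hes⟩ := Finset.exists_of_ssubset hss
    have hsub : s ⊆ s'.erase e := Finset.subset_erase.2 ⟨hss.1, hes⟩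
    have hlast := step (s'.erase e) ((Finset.erase_subset _ _).trans hs') (hne.mono hsub) e
      (Finset.mem_range.1 (hs' he)) (Finset.notMem_erase _ _)
    rw [Finset.insert_erase he] at hlast
    rcases hsub.eq_or_ssubset with h | h
    · rwa [h]
    · exact (ih _ (Finset.erase_ssubset he) ((Finset.erase_subset _ _).trans hs') h).trans hlast

/-- The angle of the `j`-th point of the antipodal point set, unrolled along the real line. -/
noncomputable def liftAngle {n : ℕ} [NeZero n] (θ : Fin n → ℝ) (j : ℕ) : ℝ :=
  θ (Fin.ofNat n j) + (j / n : ℕ) * Real.pi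

/-- Whether the `j`-th point of the unrolled antipodal point set is selected by `ε`. -/
def selected {n : ℕ} [NeZero n] (ε : Fin n → Bool) (j : ℕ) : Prop :=
  ε (Fin.ofNat n j) = true ↔ Even (j / n)

/-- Whether exactly one of the `j`-th and `j + 1`-st points satisfies `σ`. -/
def switch (σ : ℕ → Prop) (j : ℕ) : Prop := σ (j + 1) ↔ ¬σ j

section Lift

variable {n : ℕ} [NeZero n] (θ : Fin n → ℝ) (ε : Fin n → Bool)

lemma ofNat_add_period (j : ℕ) : Fin.ofNat n (j + n) = Fin.ofNat n j := by
  ext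
  simp [Fin.ofNat]

lemma liftAngle_add_period (j : ℕ) : liftAngle θ (j + n) = liftAngle θ j + Real.pi := by
  rw [liftAngle, liftAngle, ofNat_add_period, Nat.add_div_right _ (NeZero.pos n)]
  push_cast
  ring

lemma liftAngle_strictMono (hmono : StrictMono θ) (hrange : ∀ i, θ i ∈ Set.Ico 0 Real.pi) :
    StrictMono (liftAngle θ) := by
  have hn := NeZero.pos n
  refine strictMono_nat_of_lt_succ fun j => ?_
  have hr := Nat.mod_lt j hn
  have hj := Nat.div_add_mod j n
  rcases (show j % n + 1 ≤ n by omega).lt_or_eq with h | h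
  · obtain ⟨hd, hm⟩ := (Nat.div_mod_unique (a := j + 1) (d := j / n) (c := j % n + 1) hn).2
      ⟨by omega, h⟩
    rw [liftAngle, liftAngle, hd, add_lt_add_iff_right]
    apply hmono
    rw [Fin.lt_def]
    simp [Fin.ofNat, hm]
  · obtain ⟨hd, hm⟩ := (Nat.div_mod_unique (a := j + 1) (d := j / n + 1) (c := 0) hn).2
      ⟨by rw [mul_add]; omega, hn⟩
    rw [liftAngle, liftAngle, hd]
    have h1 := (hrange (Fin.ofNat n j)).2
    have h2 := (hrange (Fin.ofNat n (j + 1))).1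
    push_cast
    linarith

lemma selected_add_period (j : ℕ) : selected ε (j + n) ↔ ¬selected ε j := by
  rw [selected, selected, ofNat_add_period, Nat.add_div_right _ (NeZero.pos n),
    Nat.even_add_one]
  tauto

lemma pt_liftAngle (j : ℕ) :
    pt (liftAngle θ j) = (-1 : ℝ) ^ (j / n) • pt (θ (Fin.ofNat n j)) := by
  ext <;> simp [pt, liftAngle, Real.cos_add_nat_mul_pi, Real.sin_add_nat_mul_pi]

lemma vtx_of_selected {j : ℕ} (h : selected ε j) :
    vtx θ ε (Fin.ofNat n j) = pt (liftAngle θ j) := by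
  rw [pt_liftAngle, vtx]
  by_cases he : ε (Fin.ofNat n j) = true
  · rw [if_pos he, (h.1 he).neg_one_pow, one_smul]
  · rw [if_neg he, (Nat.not_even_iff_odd.1 fun h' => he (h.2 h')).neg_one_pow, neg_one_smul]

lemma pt_liftAngle_add_period (j : ℕ) : pt (liftAngle θ (j + n)) = -pt (liftAngle θ j) := by
  rw [liftAngle_add_period]
  ext <;> simp [pt]

lemma vtx_of_not_selected {j : ℕ} (h : ¬selected ε j) :
    vtx θ ε (Fin.ofNat n j) = -pt (liftAngle θ j) := by
  rw [← ofNat_add_period, vtx_of_selected _ _ ((selected_add_period ε j).2 h),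
    pt_liftAngle_add_period]

lemma apoly_eq : apoly θ ε =
    convexHull ℝ ((fun j => pt (liftAngle θ j)) '' {j | j < 2 * n ∧ selected ε j}) := by
  rw [apoly]
  congr 1
  ext z
  constructor
  · rintro ⟨i, rfl⟩
    have hi : Fin.ofNat n i.1 = i := by ext; simp [Fin.ofNat, Nat.mod_eq_of_lt i.2]
    by_cases h : selected ε i.1
    · exact ⟨i.1, ⟨by omega, h⟩, by simp only [← vtx_of_selected θ ε h, hi]⟩
    · have h' := (selected_add_period ε i.1).2 h
      exact ⟨i.1 + n, ⟨by omega, h'⟩, by simp only [← vtx_of_selected θ ε h', ofNat_add_period, hi]⟩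
  · rintro ⟨j, ⟨-, hj⟩, rfl⟩
    exact ⟨_, vtx_of_selected θ ε hj⟩

end Lift

section Antiperiodic

variable {n : ℕ} {σ : ℕ → Prop}

lemma switch_add_period (hσ : ∀ j, σ (j + n) ↔ ¬σ j) (j : ℕ) :
    switch σ (j + n) ↔ switch σ j := by
  rw [switch, switch, add_right_comm, hσ, hσ]
  tauto

lemma arcEnd_switch {a b : ℕ} (ha : σ a) (hb : σ b) (hab : a < b)
    (hno : ∀ i, a < i → i < b → ¬σ i) : arcEnd (switch σ) a = b := by
  rcases (show a + 1 ≤ b from hab).eq_or_lt with rfl | h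
  · exact arcEnd_of_not fun h => h.1 hb ha
  · have h1 := hno (a + 1) (by omega) h
    have hb1 : b - 1 + 1 = b := by omega
    rw [arcEnd_eq (k := b - 1) ⟨fun h' => absurd h' h1, fun h' => absurd ha h'⟩ (by omega)
      ?_ ?_, hb1]
    · rw [switch, hb1]
      exact ⟨fun _ => hno _ (by omega) (by omega), fun _ => hb⟩
    · intro i hi1 hi2 h'
      exact hno (i + 1) (by omega) (by omega) (h'.2 (hno i hi1 (by omega)))

open Classical in
lemma sum_filter_antiperiodic (hσ : ∀ j, σ (j + n) ↔ ¬σ j) {M : Type*} [AddCommMonoid M]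
    {g : ℕ → M} (hg : ∀ j, g (j + n) = g j) :
    ∑ j ∈ Finset.range (2 * n) with σ j, g j = ∑ j ∈ Finset.range n, g j := by
  rw [Finset.sum_filter, two_mul, Finset.sum_range_add, ← Finset.sum_add_distrib]
  refine Finset.sum_congr rfl fun j _ => ?_
  rw [add_comm n j, hg]
  by_cases h : σ j
  · rw [if_pos h, if_neg (fun h' => (hσ j).1 h' h), add_zero]
  · rw [if_neg h, if_pos ((hσ j).2 h), zero_add]

lemma volume_real_antipodal (hn : 2 ≤ n) {t : ℕ → ℝ} (ht : StrictMono t)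
    (htn : ∀ j, t (j + n) = t j + Real.pi) (hσ : ∀ j, σ (j + n) ↔ ¬σ j) :
    volume.real (convexHull ℝ ((fun j => pt (t j)) '' {j | j < 2 * n ∧ σ j})) =
      stdTriArea * arcSum n t (switch σ) := by
  classical
  have hσ2 : ∀ j, σ (2 * n + j) ↔ σ j := fun j => by
    rw [show 2 * n + j = j + n + n by ring, hσ, hσ, not_not]
  have hinf : (Set.ofPred σ).Infinite := by
    refine Set.infinite_of_forall_exists_gt fun a => ?_
    by_cases h : σ (a + n)
    · exact ⟨a + n, h, by omega⟩
    · exact ⟨a + n + n, (hσ _).2 h, by omega⟩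
  set c := Nat.nth σ with hc
  have hcmono : StrictMono c := Nat.nth_strictMono hinf
  have hcσ : ∀ i, σ (c i) := Nat.nth_mem_of_infinite hinf
  have hcount : Nat.count σ (2 * n) = n := by
    rw [Nat.count_eq_card_filter_range, Finset.card_eq_sum_ones,
      sum_filter_antiperiodic hσ (g := fun _ => 1) (fun _ => rfl)]
    simp
  have hclt : ∀ i, c i < 2 * n ↔ i < n := fun i => by
    rw [← Nat.lt_nth_iff_count_lt hinf, hcount]
  have hcn : c n = 2 * n + c 0 := by
    have h1 : Nat.count σ (2 * n + c 0) = n := by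
      rw [Nat.count_add, hcount]
      simp only [hσ2]
      rw [hc, Nat.count_nth_of_infinite hinf, add_zero]
    have h2 := Nat.nth_count (p := σ) ((hσ2 (c 0)).2 (hcσ 0))
    rwa [h1] at h2
  have htcn : t (c n) = t (c 0) + 2 * Real.pi := by
    rw [hcn, show 2 * n + c 0 = c 0 + n + n by ring, htn, htn]
    ring
  have harc : ∀ i, arcEnd (switch σ) (c i) = c (i + 1) := fun i =>
    arcEnd_switch (hcσ i) (hcσ _) (hcmono (Nat.lt_succ_self i)) fun a h1 h2 h3 =>
      (Nat.le_nth_of_lt_nth_succ h2 h3).not_gt h1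
  have himage : (fun j => pt (t j)) '' {j | j < 2 * n ∧ σ j} =
      (fun i => pt (t (c i))) '' Set.Iic (n - 2 + 1) := by
    ext z
    constructor
    · rintro ⟨j, ⟨hj, hσj⟩, rfl⟩
      have hcj : c (Nat.count σ j) = j := Nat.nth_count hσj
      refine ⟨Nat.count σ j, ?_, by simp only [hcj]⟩
      have := (hclt (Nat.count σ j)).1 (by omega)
      rw [Set.mem_Iic]
      omega
    · rintro ⟨i, hi, rfl⟩
      rw [Set.mem_Iic] at hi
      exact ⟨c i, ⟨(hclt i).2 (by omega), hcσ i⟩, rfl⟩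
  have hsum : ∑ i ∈ Finset.range n, Real.sin (t (c (i + 1)) - t (c i)) =
      arcSum n t (switch σ) := by
    rw [arcSum, ← sum_filter_antiperiodic hσ
      (g := fun j => Real.sin (t (arcEnd (switch σ) j) - t j))]
    · refine Finset.sum_bij (fun i _ => c i) ?_ (fun _ _ _ _ h => hcmono.injective h) ?_ ?_
      · intro i hi
        rw [Finset.mem_filter, Finset.mem_range]
        exact ⟨(hclt i).2 (Finset.mem_range.1 hi), hcσ i⟩
      · intro j hj
        rw [Finset.mem_filter, Finset.mem_range] at hj
        have hcj : c (Nat.count σ j) = j := Nat.nth_count hj.2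
        exact ⟨Nat.count σ j, Finset.mem_range.2 ((hclt _).1 (by omega)), hcj⟩
      · intro i _
        rw [harc]
    · intro j
      rw [arcEnd_add_period (by omega) (switch_add_period hσ), htn, htn, add_sub_add_right_eq_sub]
  have hsucc : n - 2 + 1 + 1 = n := by omega
  have hlast := ht (hcmono (show n - 2 + 1 < n by omega))
  rw [himage, volume_real_inscribed (fun i => t (c i)) (fun i j h => ht (hcmono h)) _
    (by linarith), ← hsum]
  congr 1
  conv_rhs => rw [← hsucc, Finset.sum_range_succ, hsucc, htcn]
  congr 1
  rw [← Real.sin_add_two_pi]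
  ring_nf

open Classical in
lemma iff_even_count_switch (σ : ℕ → Prop) (j : ℕ) :
    σ j ↔ (σ 0 ↔ Even (Nat.count (switch σ) j)) := by
  induction j with
  | zero => simp
  | succ j ih =>
    rw [Nat.count_succ]
    by_cases h : switch σ j
    · rw [if_pos h, Nat.even_add_one]
      rw [switch] at h
      tauto
    · rw [if_neg h, add_zero, ← ih]
      rw [switch] at h
      tauto

lemma exists_switchSet (hn : 0 < n) (hσ : ∀ j, σ (j + n) ↔ ¬σ j) :
    ∃ s ⊆ Finset.range n, Odd s.card ∧ switch σ = fun j => j % n ∈ s := by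
  classical
  refine ⟨Finset.range n |>.filter (switch σ), Finset.filter_subset _ _, ?_, ?_⟩
  · rw [← Nat.count_eq_card_filter_range, ← Nat.not_even_iff_odd]
    intro h
    have h1 := iff_even_count_switch σ n
    have h2 := hσ 0
    rw [zero_add] at h2
    tauto
  · have hper : Function.Periodic (switch σ) n := fun j => propext (switch_add_period hσ j)
    ext j
    rw [Finset.mem_filter, hper.map_mod_nat, Finset.mem_range]
    exact ⟨fun h => ⟨Nat.mod_lt j hn, h⟩, fun h => h.2⟩

lemma exists_selection [NeZero n] {s : Finset ℕ} (hs : s ⊆ Finset.range n) (hodd : Odd s.card) :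
    ∃ ε : Fin n → Bool, switch (selected ε) = fun j => j % n ∈ s := by
  classical
  set T : ℕ → Prop := fun j => j % n ∈ s with hT
  have hn := NeZero.pos n
  have hTn : ∀ j, T (n + j) ↔ T j := fun j => by simp only [hT, Nat.add_mod_left]
  have hcard : Nat.count T n = s.card := by
    rw [Nat.count_eq_card_filter_range]
    congr 1
    ext j
    simp only [hT, Finset.mem_filter, Finset.mem_range]
    constructor
    · rintro ⟨h1, h2⟩
      rwa [Nat.mod_eq_of_lt h1] at h2
    · intro h
      have := Finset.mem_range.1 (hs h)
      exact ⟨this, by rwa [Nat.mod_eq_of_lt this]⟩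
  let ε : Fin n → Bool := fun i => decide (Even (Nat.count T i))
  have key : ∀ j, selected ε j ↔ Even (Nat.count T j) := by
    intro j
    induction j using Nat.strong_induction_on with
    | _ j ih =>
      rcases lt_or_ge j n with h | h
      · simp [selected, ε, Nat.div_eq_of_lt h, Fin.ofNat, Nat.mod_eq_of_lt h]
      · obtain ⟨i, rfl⟩ : ∃ i, j = i + n := ⟨j - n, by omega⟩
        rw [selected_add_period, ih i (by omega), add_comm i n, Nat.count_add, hcard]
        simp only [hTn]
        rw [Nat.even_add]
        have := Nat.not_even_iff_odd.2 hodd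
        tauto
  refine ⟨ε, funext fun j => propext ?_⟩
  rw [switch, key, key, Nat.count_succ]
  by_cases h : T j
  · rw [if_pos h, Nat.even_add_one]
    exact ⟨fun _ => h, fun _ => Iff.rfl⟩
  · rw [if_neg h, add_zero]
    exact ⟨fun h' => absurd h' (by tauto), fun h' => absurd h' h⟩

end Antiperiodic

section ThinThick

variable {n : ℕ} [NeZero n] {θ : Fin n → ℝ} {ε : Fin n → Bool}

lemma thin_of_switch_singleton (hmono : StrictMono θ) (hrange : ∀ i, θ i ∈ Set.Ico 0 Real.pi)
    {e : ℕ} (hs : switch (selected ε) = fun j => j % n ∈ ({e} : Finset ℕ)) (he : e < n) :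
    Thin θ ε := by
  have hn := NeZero.pos n
  have ht := liftAngle_strictMono θ hmono hrange
  have hnot : ∀ j, e < j → j < e + n → ¬switch (selected ε) j := by
    intro j h1 h2 h3
    rw [hs] at h3
    have h4 : j % n = e % n := by rw [Finset.mem_singleton.1 h3, Nat.mod_eq_of_lt he]
    have := eq_of_mod_eq_of_lt h4 h2 (by omega)
    omega
  have hconst : ∀ m, m < n → (selected ε (e + 1 + m) ↔ selected ε (e + 1)) := by
    intro m
    induction m with
    | zero => intro _; rfl
    | succ m ih =>
      intro hm
      have h1 := hnot (e + 1 + m) (by omega) (by omega)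
      rw [switch] at h1
      have h2 := ih (by omega)
      rw [← add_assoc]
      tauto
  set τ := liftAngle θ (e + 1) with hτ
  have hrep : ∀ i : Fin n, ∃ j, Fin.ofNat n j = i ∧ (selected ε j ↔ selected ε (e + 1)) ∧
      0 ≤ Real.sin (liftAngle θ j - τ) := by
    intro i
    obtain ⟨j, h1, h2, h3⟩ := exists_mem_window (T := fun j => Fin.ofNat n j = i) hn
      (fun j => by rw [ofNat_add_period]) ⟨i.1, by ext; simp [Fin.ofNat, Nat.mod_eq_of_lt i.2]⟩
      (e + 1)
    obtain ⟨m, rfl⟩ := Nat.exists_eq_add_of_le h1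
    refine ⟨_, h3, hconst m (by omega), Real.sin_nonneg_of_nonneg_of_le_pi ?_ ?_⟩
    · linarith [ht.monotone h1]
    · have := ht h2
      rw [liftAngle_add_period] at this
      linarith
  have hv : ((-Real.sin τ, Real.cos τ) : ℝ × ℝ) ≠ 0 := by
    intro h
    rw [Prod.mk_eq_zero] at h
    have := Real.sin_sq_add_cos_sq τ
    rw [h.2, neg_eq_zero.1 h.1] at this
    norm_num at this
  have hdot : ∀ x, dotp (-Real.sin τ, Real.cos τ) (pt x) = Real.sin (x - τ) := by
    intro x
    simp only [dotp, pt, Real.sin_sub]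
    ring
  by_cases h0 : selected ε (e + 1)
  · refine ⟨_, hv, fun i => ?_⟩
    obtain ⟨j, rfl, hj, hsin⟩ := hrep i
    rwa [vtx_of_selected θ ε (hj.2 h0), hdot]
  · refine ⟨_, neg_ne_zero.2 hv, fun i => ?_⟩
    obtain ⟨j, rfl, hj, hsin⟩ := hrep i
    rw [vtx_of_not_selected θ ε (fun h => h0 (hj.1 h))]
    have : dotp (-(-Real.sin τ, Real.cos τ)) (-pt (liftAngle θ j)) =
        dotp (-Real.sin τ, Real.cos τ) (pt (liftAngle θ j)) := by
      simp [dotp]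
    rwa [this, hdot]

/-- Up to positive scaling, every linear functional on the circle is a shifted sine, with a shift
as large as desired. -/
lemma exists_dotp_pt_eq {v : ℝ × ℝ} (hv : v ≠ 0) (B : ℝ) :
    ∃ r > 0, ∃ ψ > B, ∀ τ, dotp v (pt τ) = r * Real.sin (τ - ψ) := by
  let z : ℂ := ⟨v.1, v.2⟩
  have hz : z ≠ 0 := fun h => hv (Prod.ext (congrArg Complex.re h) (congrArg Complex.im h))
  obtain ⟨k, hk⟩ := exists_nat_gt ((B - (z.arg - Real.pi / 2)) / (2 * Real.pi))
  rw [div_lt_iff₀ (by positivity)] at hk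
  refine ⟨‖z‖, norm_pos_iff.2 hz, z.arg - Real.pi / 2 + k * (2 * Real.pi), by linarith,
    fun τ => ?_⟩
  have h1 : ‖z‖ * Real.cos z.arg = v.1 := Complex.norm_mul_cos_arg z
  have h2 : ‖z‖ * Real.sin z.arg = v.2 := Complex.norm_mul_sin_arg z
  rw [show τ - (z.arg - Real.pi / 2 + k * (2 * Real.pi)) =
    τ - z.arg + Real.pi / 2 - k * (2 * Real.pi) by ring, Real.sin_sub_nat_mul_two_pi,
    Real.sin_add_pi_div_two, Real.cos_sub, dotp, pt, ← h1, ← h2]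
  ring

/-- If almost all edges are switches, a window of `n - 1` points splits into consecutive pairs
joined by switches, with at most one point left over. -/
lemma exists_switch_pairs {σ : ℕ → Prop} {s : Finset ℕ} (hsub : s ⊆ Finset.range n)
    (hs : switch σ = fun j => j % n ∈ s) (hodd : Odd s.card) (hcard : n ≤ s.card + 1) (a : ℕ) :
    ∃ c, ∀ i < (n - 1) / 2, c + 2 * i + 2 < n ∧ switch σ (a + c + 2 * i) := by
  have hn := NeZero.pos n
  by_cases hall : ∀ j, a ≤ j → j < a + n → switch σ j
  · exact ⟨0, fun i hi => ⟨by omega, hall _ (by omega) (by omega)⟩⟩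
  push Not at hall
  obtain ⟨d, had, hdn, hd⟩ := hall
  rw [hs] at hd
  have hmem : ∀ j, j % n ∈ Finset.range n := fun j => Finset.mem_range.2 (Nat.mod_lt j hn)
  have hle : s.card + 1 ≤ n := by
    have := Finset.card_le_card (Finset.insert_subset (hmem d) hsub)
    rwa [Finset.card_insert_of_notMem hd, Finset.card_range] at this
  have huniq : ∀ j, a ≤ j → j < a + n → j ≠ d → switch σ j := by
    intro j h1 h2 h3
    rw [hs]
    by_contra hj
    have hne : d % n ≠ j % n := fun h => h3 (eq_of_mod_eq_of_lt h.symm (by omega) (by omega))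
    have := Finset.card_le_card
      (Finset.insert_subset (hmem d) (Finset.insert_subset (hmem j) hsub))
    rw [Finset.card_insert_of_notMem (by simp only [Finset.mem_insert, not_or]; exact ⟨hne, hd⟩),
      Finset.card_insert_of_notMem hj, Finset.card_range] at this
    omega
  obtain ⟨m, hm⟩ := hodd
  rcases Nat.even_or_odd' (d - a) with ⟨b, hb | hb⟩
  · exact ⟨1, fun i hi => ⟨by omega, huniq _ (by omega) (by omega) (by omega)⟩⟩
  · exact ⟨0, fun i hi => ⟨by omega, huniq _ (by omega) (by omega) (by omega)⟩⟩

lemma thick_of_card_switch (hmono : StrictMono θ)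
    (hrange : ∀ i, θ i ∈ Set.Ico 0 Real.pi) {s : Finset ℕ} (hsub : s ⊆ Finset.range n)
    (hs : switch (selected ε) = fun j => j % n ∈ s) (hodd : Odd s.card) (hcard : n ≤ s.card + 1) :
    Thick θ ε := by
  classical
  intro v hv
  have ht := liftAngle_strictMono θ hmono hrange
  obtain ⟨r, hr, ψ, hψ, hdot⟩ := exists_dotp_pt_eq hv (liftAngle θ 0)
  have hex : ∃ j, ψ < liftAngle θ j := by
    obtain ⟨k, hk⟩ := exists_nat_gt (ψ / Real.pi)
    rw [div_lt_iff₀ Real.pi_pos] at hk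
    refine ⟨k * n, hk.trans_le ?_⟩
    rw [liftAngle, Nat.mul_div_cancel _ (NeZero.pos n)]
    linarith [(hrange (Fin.ofNat n (k * n))).1]
  obtain ⟨a, ha⟩ : ∃ a, ψ < liftAngle θ (a + 1) ∧ liftAngle θ a ≤ ψ := by
    have h0 : Nat.find hex ≠ 0 := fun h => by
      have := Nat.find_spec hex
      rw [h] at this
      linarith
    obtain ⟨a, ha⟩ := Nat.exists_eq_succ_of_ne_zero h0
    refine ⟨a, ?_, not_lt.1 (Nat.find_min hex (by omega))⟩
    have := Nat.find_spec hex
    rwa [ha] at this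
  have hpos : ∀ j, a + 1 ≤ j → j < a + n → selected ε j →
      0 < dotp v (vtx θ ε (Fin.ofNat n j)) := by
    intro j h1 h2 hj
    rw [vtx_of_selected θ ε hj, hdot]
    have h3 := ht.monotone h1
    have h4 := ht h2
    rw [liftAngle_add_period] at h4
    exact mul_pos hr (Real.sin_pos_of_pos_of_lt_pi (by linarith) (by linarith))
  obtain ⟨c, hc⟩ := exists_switch_pairs hsub hs hodd hcard (a + 1)
  let f : ℕ → ℕ := fun i =>
    if selected ε (a + 1 + c + 2 * i) then a + 1 + c + 2 * i else a + 1 + c + 2 * i + 1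
  have hfle : ∀ i, a + 1 + c + 2 * i ≤ f i ∧ f i ≤ a + 1 + c + 2 * i + 1 := fun i => by
    simp only [f]
    split_ifs <;> omega
  have hfsel : ∀ i < (n - 1) / 2, selected ε (f i) := by
    intro i hi
    by_cases h : selected ε (a + 1 + c + 2 * i)
    · simpa only [f, if_pos h] using h
    · simpa only [f, if_neg h] using (hc i hi).2.2 h
  have hinj : Set.InjOn (fun i => Fin.ofNat n (f i)) (Finset.range ((n - 1) / 2)) := by
    intro i hi j hj hij
    rw [Finset.mem_coe, Finset.mem_range] at hi hj
    have h1 := (hc i hi).1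
    have h2 := (hc j hj).1
    have h3 := hfle i
    have h4 := hfle j
    have := eq_of_mod_eq_of_lt (n := n) (i := f i) (j := f j) (congrArg Fin.val hij)
      (by omega) (by omega)
    omega
  rw [← Finset.card_range ((n - 1) / 2), ← Set.ncard_coe_finset, ← hinj.ncard_image]
  refine Set.ncard_le_ncard ?_ (Set.toFinite _)
  rintro _ ⟨i, hi, rfl⟩
  rw [Finset.mem_coe, Finset.mem_range] at hi
  have h1 := (hc i hi).1
  have h3 := hfle i
  exact hpos _ (by omega) (by omega) (hfsel i hi)

end ThinThick

lemma volume_real_apoly_s17 {n : ℕ} [NeZero n] (hn : 2 ≤ n) {θ : Fin n → ℝ} (hmono : StrictMono θ)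
    (hrange : ∀ i, θ i ∈ Set.Ico 0 Real.pi) (ε : Fin n → Bool) :
    volume.real (apoly θ ε) =
      stdTriArea * arcSum n (liftAngle θ) (switch (selected ε)) := by
  rw [apoly_eq]
  exact volume_real_antipodal hn (liftAngle_strictMono θ hmono hrange) (liftAngle_add_period θ)
    (selected_add_period ε)

lemma volume_apoly_le_iff {n : ℕ} [NeZero n] (hn : 2 ≤ n) {θ : Fin n → ℝ} (hmono : StrictMono θ)
    (hrange : ∀ i, θ i ∈ Set.Ico 0 Real.pi) (ε ε' : Fin n → Bool) :
    volume (apoly θ ε) ≤ volume (apoly θ ε') ↔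
      arcSum n (liftAngle θ) (switch (selected ε)) ≤
        arcSum n (liftAngle θ) (switch (selected ε')) := by
  rw [← mul_le_mul_iff_right₀ stdTriArea_pos, ← volume_real_apoly_s17 hn hmono hrange,
    ← volume_real_apoly_s17 hn hmono hrange]
  exact (ENNReal.toReal_le_toReal (volume_convexHull_lt_top (Set.finite_range _)).ne
    (volume_convexHull_lt_top (Set.finite_range _)).ne).symm

/-- An antipodal polygon of minimum area is thin and one of maximum area is
thick. -/
theorem stmt_17 (n : ℕ) (hn : 3 ≤ n) (θ : Fin n → ℝ) (hmono : StrictMono θ)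
    (hrange : ∀ i, θ i ∈ Set.Ico 0 Real.pi) (ε : Fin n → Bool) :
    ((∀ ε' : Fin n → Bool, volume (apoly θ ε) ≤ volume (apoly θ ε')) → Thin θ ε) ∧
    ((∀ ε' : Fin n → Bool, volume (apoly θ ε') ≤ volume (apoly θ ε)) → Thick θ ε) := by
  have : NeZero n := ⟨by omega⟩
  have ht := liftAngle_strictMono θ hmono hrange
  obtain ⟨s, hsub, hodd, hs⟩ := exists_switchSet (by omega) (selected_add_period ε)
  simp only [volume_apoly_le_iff (by omega : 2 ≤ n) hmono hrange]
  constructor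
  · intro hmin
    obtain ⟨e, he⟩ := Finset.card_pos.1 hodd.pos
    have hen : {e} ⊆ Finset.range n := Finset.singleton_subset_iff.2 (hsub he)
    obtain ⟨ε', hε'⟩ := exists_selection hen (by simp)
    rcases (Finset.singleton_subset_iff.2 he).eq_or_ssubset with rfl | h
    · exact thin_of_switch_singleton hmono hrange hs (Finset.mem_range.1 (hsub he))
    · have h1 := arcSum_lt_of_ssubset hn ht (liftAngle_add_period θ) hsub
        (Finset.singleton_nonempty e) h
      rw [← hs, ← hε'] at h1
      exact absurd (hmin ε') (not_le.2 h1)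
  · intro hmax
    by_cases hcard : n ≤ s.card + 1
    · exact thick_of_card_switch hmono hrange hsub hs hodd hcard
    · obtain ⟨s', hss', hs'n, hs'card⟩ := Finset.exists_subsuperset_card_eq hsub
        (show s.card ≤ s.card + 2 by omega) (by rw [Finset.card_range]; omega)
      obtain ⟨ε', hε'⟩ := exists_selection hs'n (by rw [hs'card]; exact hodd.add_even even_two)
      have hssub : s ⊂ s' := hss'.ssubset_of_ne (fun h => by rw [h] at hs'card; omega)
      have h1 := arcSum_lt_of_ssubset hn ht (liftAngle_add_period θ) hs'n
        (Finset.card_pos.1 hodd.pos) hssub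
      rw [← hs, ← hε'] at h1
      exact absurd (hmax ε') (not_le.2 h1)
end
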